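/- arXiv:2108.02364 — 3 statements merged into one kernel-verified Lean document; each statement's English description precedes it below -/
import Mathlib

section
/- Let t ≥ 4 and 2 ≤ s ≤ t. There exists n₀ such that for all n ≥ n₀ the following holds: with G⋆ and K as in the extremal setup, if G⋆ − K has a connected component with exactly t+1 vertices, then G⋆ − K has no connected component with fewer than t vertices and no connected component with exactly t+2 vertices. -/
open SimpleGraph

/-- `H` is a minor of `G` (branch-set definition). -/
def MinorOf {α β : Type} (H : SimpleGraph α) (G : SimpleGraph β) : Prop :=
  ∃ φ : α → Set β,
    (∀ a, (G.induce (φ a)).Connected) ∧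
    (Pairwise fun a b => Disjoint (φ a) (φ b)) ∧
    (∀ a b, H.Adj a b → ∃ x ∈ φ a, ∃ y ∈ φ b, G.Adj x y)

/-- Adjacency matrix over ℝ. -/
noncomputable def adjMat {V : Type} [Fintype V] (G : SimpleGraph V) : Matrix V V ℝ :=
  letI := Classical.decRel G.Adj
  SimpleGraph.adjMatrix ℝ G

theorem adjMat_herm {V : Type} [Fintype V] (G : SimpleGraph V) : (adjMat G).IsHermitian := by
  letI := Classical.decRel G.Adj
  ext i j
  simp [adjMat, Matrix.conjTranspose_apply, SimpleGraph.adjMatrix_apply, SimpleGraph.adj_comm]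

/-- Spectral radius = largest adjacency eigenvalue. -/
noncomputable def specRad {V : Type} [Fintype V] [DecidableEq V] (G : SimpleGraph V) : ℝ :=
  ⨆ i, (adjMat_herm G).eigenvalues i

/-- degree -/
noncomputable def deg {V : Type} (G : SimpleGraph V) (v : V) : ℕ := (G.neighborSet v).ncard

/-- number of edges -/
noncomputable def ecard {V : Type} (G : SimpleGraph V) : ℕ := G.edgeSet.ncard

/-- k disjoint copies of G -/
def copies (k : ℕ) {V : Type} (G : SimpleGraph V) : SimpleGraph (Fin k × V) :=
  SimpleGraph.fromRel fun x y => x.1 = y.1 ∧ G.Adj x.2 y.2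

/-- disjoint union -/
def gUnion {V W : Type} (G : SimpleGraph V) (H : SimpleGraph W) : SimpleGraph (V ⊕ W) :=
  SimpleGraph.fromRel fun x y =>
    (∃ a b, x = Sum.inl a ∧ y = Sum.inl b ∧ G.Adj a b) ∨
    (∃ a b, x = Sum.inr a ∧ y = Sum.inr b ∧ H.Adj a b)

/-- join -/
def gJoin {V W : Type} (G : SimpleGraph V) (H : SimpleGraph W) : SimpleGraph (V ⊕ W) :=
  SimpleGraph.fromRel fun x y =>
    (∃ a b, x = Sum.inl a ∧ y = Sum.inl b ∧ G.Adj a b) ∨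
    (∃ a b, x = Sum.inr a ∧ y = Sum.inr b ∧ H.Adj a b) ∨
    (∃ a b, x = Sum.inl a ∧ y = Sum.inr b)

/-- Petersen graph (Kneser graph K(5,2)). -/
def petersen : SimpleGraph {s : Finset (Fin 5) // s.card = 2} :=
  SimpleGraph.fromRel fun a b => Disjoint a.1 b.1

/-- star K_{1,m} -/
def starG (m : ℕ) : SimpleGraph (Fin 1 ⊕ Fin m) := completeBipartiteGraph (Fin 1) (Fin m)

/-- the star forest H_{s,t} -/
def Hst (s t : ℕ) :
    SimpleGraph ((Fin ((t+1)/(s+1) - 1) × (Fin 1 ⊕ Fin s)) ⊕ (Fin 1 ⊕ Fin (t - ((t+1)/(s+1) - 1) * (s+1)))) :=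
  gUnion (copies ((t+1)/(s+1) - 1) (starG s)) (starG (t - ((t+1)/(s+1) - 1) * (s+1)))

/-- subdivide the edge uv of G by a path through k new vertices -/
def subdividePath {V : Type} (G : SimpleGraph V) (u v : V) (k : ℕ) : SimpleGraph (V ⊕ Fin k) :=
  SimpleGraph.fromRel fun x y =>
    (∃ a b, x = Sum.inl a ∧ y = Sum.inl b ∧ G.Adj a b ∧ ¬(a = u ∧ b = v) ∧ ¬(a = v ∧ b = u)) ∨
    (∃ i : Fin k, x = Sum.inl u ∧ y = Sum.inr i ∧ (i : ℕ) = 0) ∨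
    (∃ i j : Fin k, x = Sum.inr i ∧ y = Sum.inr j ∧ (j : ℕ) = (i : ℕ) + 1) ∨
    (∃ i : Fin k, x = Sum.inr i ∧ y = Sum.inl v ∧ (i : ℕ) = k - 1)

/-- (s,t)-property -/
def HasSTProp (s t : ℕ) {V : Type} (G : SimpleGraph V) : Prop :=
  ∀ a b : ℕ, 1 ≤ a → 1 ≤ b → a + b = t + 1 → a ≤ min s ((t+1)/2) →
    ¬ MinorOf (completeBipartiteGraph (Fin a) (Fin b)) G

/-- H_{a,b,c} -/
def Habc (a b c : ℕ) : SimpleGraph (Fin 3 ⊕ (Fin a ⊕ Fin b ⊕ Fin c)) :=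
  SimpleGraph.fromRel fun x y =>
    (x = Sum.inl 0 ∧ y = Sum.inl 1) ∨
    (x = Sum.inl 0 ∧ ∃ i : Fin a, y = Sum.inr (Sum.inl i)) ∨
    (x = Sum.inl 0 ∧ ∃ i : Fin b, y = Sum.inr (Sum.inr (Sum.inl i))) ∨
    (x = Sum.inl 1 ∧ ∃ i : Fin a, y = Sum.inr (Sum.inl i)) ∨
    (x = Sum.inl 1 ∧ ∃ i : Fin c, y = Sum.inr (Sum.inr (Sum.inr i))) ∨
    (x = Sum.inl 2 ∧ ∃ i : Fin b, y = Sum.inr (Sum.inr (Sum.inl i))) ∨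
    (x = Sum.inl 2 ∧ ∃ i : Fin c, y = Sum.inr (Sum.inr (Sum.inr i)))

noncomputable def edgeDegSum {V : Type} (G H : SimpleGraph V) : ℕ :=
  ∑ᶠ e ∈ G.edgeSet, Sym2.lift ⟨fun u v => deg H u + deg H v, fun u v => by dsimp; ring⟩ e

section PartMinor

/-- The component property: no `K_{a,b}` minor with `a+b=t+1`, `1 ≤ a ≤ s`. -/
def PP (s t : ℕ) {V : Type} (H : SimpleGraph V) : Prop :=
  ∀ a b : ℕ, 1 ≤ a → a ≤ s → 1 ≤ b → a + b = t + 1 →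
    ¬ MinorOf (completeBipartiteGraph (Fin a) (Fin b)) H

theorem minor_sub {α β α' β' V : Type} {G : SimpleGraph V} (i : α' ↪ α) (j : β' ↪ β)
    (h : MinorOf (completeBipartiteGraph α β) G) : MinorOf (completeBipartiteGraph α' β') G := by
  obtain ⟨φ, h1, h2, h3⟩ := h
  refine ⟨fun x => φ (Sum.map i j x), fun a => h1 _, ?_, ?_⟩
  · intro a b hab
    exact h2 (fun h => hab ((Sum.map_injective.2 ⟨i.injective, j.injective⟩) h))
  · intro a b hab
    apply h3
    rcases a with a | a <;> rcases b with b | b <;> simp_all [completeBipartiteGraph]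

theorem minor_mk {α β V : Type} {G : SimpleGraph V} (L : α → Set V) (R : β → Set V)
    (hL : ∀ a, (G.induce (L a)).Connected) (hR : ∀ a, (G.induce (R a)).Connected)
    (dL : ∀ a b, a ≠ b → Disjoint (L a) (L b)) (dR : ∀ a b, a ≠ b → Disjoint (R a) (R b))
    (dLR : ∀ a b, Disjoint (L a) (R b))
    (hadj : ∀ a b, ∃ x ∈ L a, ∃ y ∈ R b, G.Adj x y) :
    MinorOf (completeBipartiteGraph α β) G := by
  refine ⟨Sum.elim L R, ?_, ?_, ?_⟩
  · rintro (a | a)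
    · exact hL a
    · exact hR a
  · rintro (a | a) (b | b) hab
    · exact dL a b (fun h => hab (by rw [h]))
    · exact dLR a b
    · exact (dLR b a).symm
    · exact dR a b (fun h => hab (by rw [h]))
  · rintro (a | a) (b | b) hab
    · simp [completeBipartiteGraph] at hab
    · exact hadj a b
    · obtain ⟨x, hx, y, hy, h⟩ := hadj b a
      exact ⟨y, hy, x, hx, h.symm⟩
    · simp [completeBipartiteGraph] at hab

theorem conn_image {V W : Type} {G : SimpleGraph V} {G' : SimpleGraph W} (f : V → W) (S : Set V)
    (hf : ∀ x ∈ S, ∀ y ∈ S, G.Adj x y → G'.Adj (f x) (f y)) (hS : (G.induce S).Connected) :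
    (G'.induce (f '' S)).Connected := by
  refine SimpleGraph.Connected.map
    (⟨fun x => ⟨f x.1, Set.mem_image_of_mem f x.2⟩, ?_⟩ : G.induce S →g G'.induce (f '' S)) ?_ hS
  · intro a b hab
    exact hf _ a.2 _ b.2 hab
  · rintro ⟨_, x, hx, rfl⟩
    exact ⟨⟨x, hx⟩, rfl⟩

/-- Restrict a minor along a partially defined map. -/
theorem minor_map {α V W : Type} {M : SimpleGraph α} {G : SimpleGraph V} {G' : SimpleGraph W}
    (U : Set V) (f : V → W) (hinj : Set.InjOn f U)
    (hf : ∀ x ∈ U, ∀ y ∈ U, G.Adj x y → G'.Adj (f x) (f y))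
    (φ : α → Set V) (h1 : ∀ a, (G.induce (φ a)).Connected)
    (h2 : Pairwise fun a b => Disjoint (φ a) (φ b))
    (h3 : ∀ a b, M.Adj a b → ∃ x ∈ φ a, ∃ y ∈ φ b, G.Adj x y)
    (hU : ∀ a, φ a ⊆ U) : MinorOf M G' := by
  refine ⟨fun a => f '' φ a, fun a => conn_image f _ ?_ (h1 a), ?_, ?_⟩
  · intro x hx y hy
    exact hf x (hU a hx) y (hU a hy)
  · intro a b hab
    have hdis := Set.disjoint_left.1 (h2 hab)
    refine Set.disjoint_left.2 ?_
    rintro _ ⟨x, hx, rfl⟩ ⟨y, hy, hxy⟩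
    have heq := hinj (hU b hy) (hU a hx) hxy
    exact hdis hx (heq ▸ hy)
  · intro a b hab
    obtain ⟨x, hx, y, hy, h⟩ := h3 a b hab
    exact ⟨_, ⟨x, hx, rfl⟩, _, ⟨y, hy, rfl⟩, hf x (hU a hx) y (hU b hy) h⟩

theorem PP.of_inj {s t : ℕ} {V W : Type} {G : SimpleGraph V} {G' : SimpleGraph W}
    (h : PP s t G') (f : V → W) (hinj : Function.Injective f)
    (hf : ∀ x y, G.Adj x y → G'.Adj (f x) (f y)) : PP s t G := by
  intro a b ha has hb hab hm
  obtain ⟨φ, h1, h2, h3⟩ := hm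
  exact h a b ha has hb hab (minor_map Set.univ f hinj.injOn (fun x _ y _ => hf x y) φ h1 h2 h3
    (fun _ => Set.subset_univ _))

theorem PP.of_card {s t : ℕ} {V : Type} [Fintype V] {G : SimpleGraph V}
    (h : Fintype.card V ≤ t) : PP s t G := by
  intro a b ha has hb hab hm
  obtain ⟨φ, h1, h2, h3⟩ := hm
  have : ∀ x, ∃ y, y ∈ φ x := fun x => by
    obtain ⟨y⟩ := (h1 x).nonempty
    exact ⟨y.1, y.2⟩
  choose g hg using this
  have hinj : Function.Injective g := by
    intro x y hxy
    by_contra hne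
    exact Set.disjoint_left.1 (h2 hne) (hg x) (hxy ▸ hg y)
  have := Fintype.card_le_of_injective g hinj
  simp at this
  omega

theorem label_const {V ι : Type} {G : SimpleGraph V} (f : V → ι)
    (hf : ∀ x y, G.Adj x y → f x = f y) (S : Set V) (hS : (G.induce S).Connected) :
    ∀ x ∈ S, ∀ y ∈ S, f x = f y := by
  intro x hx y hy
  obtain ⟨w⟩ := hS.preconnected ⟨x, hx⟩ ⟨y, hy⟩
  have : ∀ (a b : S) (w : (G.induce S).Walk a b), f a = f b := by
    intro a b w
    induction w with
    | nil => rfl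
    | cons h _ ih => exact (hf _ _ h).trans ih
  exact this _ _ w

theorem PP.of_labels {s t : ℕ} {V ι : Type} {G : SimpleGraph V} (f : V → ι)
    (hf : ∀ x y, G.Adj x y → f x = f y)
    (h : ∀ i, ∃ (W : Type) (G' : SimpleGraph W) (g : V → W), PP s t G' ∧
      Set.InjOn g {v | f v = i} ∧
      ∀ x y, f x = i → f y = i → G.Adj x y → G'.Adj (g x) (g y)) : PP s t G := by
  intro a b ha has hb hab hm
  obtain ⟨φ, h1, h2, h3⟩ := hm
  have lc := fun x => label_const f hf (φ x) (h1 x)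
  have hadj : ∀ x y, (completeBipartiteGraph (Fin a) (Fin b)).Adj x y →
      ∀ u ∈ φ x, ∀ v ∈ φ y, f u = f v := by
    intro x y hxy u hu v hv
    obtain ⟨p, hp, q, hq, hpq⟩ := h3 x y hxy
    rw [lc x u hu p hp, hf _ _ hpq, lc y q hq v hv]
  obtain ⟨z⟩ := (h1 (Sum.inl ⟨0, ha⟩)).nonempty
  obtain ⟨z', hz'⟩ := (h1 (Sum.inr ⟨0, hb⟩)).nonempty
  have hall : ∀ x, ∀ u ∈ φ x, f u = f z := by
    rintro (x | x) u hu
    · rw [hadj (Sum.inl x) (Sum.inr ⟨0, hb⟩) (by simp [completeBipartiteGraph]) u hu z' hz']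
      exact (hadj (Sum.inl ⟨0, ha⟩) (Sum.inr ⟨0, hb⟩) (by simp [completeBipartiteGraph])
        z z.2 z' hz').symm
    · exact hadj (Sum.inr x) (Sum.inl ⟨0, ha⟩) (by simp [completeBipartiteGraph]) u hu z z.2
  obtain ⟨W, G', g, hP, hinj, hg⟩ := h (f z)
  exact hP a b ha has hb hab (minor_map {v | f v = f z} g hinj
    (fun x hx y hy => hg x y hx hy) φ h1 h2 h3 (fun x u hu => hall x u hu))

theorem conn_single {V : Type} (G : SimpleGraph V) (v : V) : (G.induce {v}).Connected := by
  have : Nonempty ({v} : Set V) := ⟨⟨v, rfl⟩⟩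
  refine ⟨fun a b => ?_⟩
  rw [Subsingleton.elim a b]

theorem conn_insert {V : Type} {G : SimpleGraph V} {S : Set V} (hS : (G.induce S).Connected)
    {x y : V} (hy : y ∈ S) (h : G.Adj x y) : (G.induce (insert x S)).Connected := by
  have := induce_union_connected (G := G) (s := {x, y}) (t := S)
    (induce_pair_connected_of_adj h).preconnected hS.preconnected ⟨y, by simp, hy⟩
  have e : ({x, y} ∪ S : Set V) = insert x S := by
    ext z
    simp only [Set.mem_union, Set.mem_insert_iff, Set.mem_singleton_iff]
    constructor
    · rintro ((h | h) | h)
      · exact Or.inl h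
      · exact Or.inr (h ▸ hy)
      · exact Or.inr h
    · rintro (h | h)
      · exact Or.inl (Or.inl h)
      · exact Or.inr h
  rwa [e] at this

theorem PP.star {s t : ℕ} {V : Type} {H : SimpleGraph V} (hP : PP s t H) (hs : 1 ≤ s) (ht : 1 ≤ t)
    (S : Set V) (hS : (H.induce S).Connected) (T : Finset V)
    (hT : ∀ x ∈ T, x ∉ S ∧ ∃ y ∈ S, H.Adj y x) : T.card < t := by
  by_contra hlt
  push Not at hlt
  have hm : MinorOf (completeBipartiteGraph Unit T) H := by
    refine minor_mk (fun _ => S) (fun x => {x.1}) (fun _ => hS) (fun x => conn_single H _) ?_ ?_ ?_ ?_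
    · intro a b h; exact absurd (Subsingleton.elim a b) h
    · intro a b h
      exact Set.disjoint_singleton.2 (fun h' : a.1 = b.1 => h (Subtype.ext h'))
    · intro a b
      simpa using (hT b.1 b.2).1
    · intro a b
      obtain ⟨y, hy, h⟩ := (hT b.1 b.2).2
      exact ⟨y, hy, b.1, rfl, h⟩
  refine hP 1 t le_rfl hs ht (by omega) (minor_sub ?_ ?_ hm)
  · exact ⟨fun _ => (), fun a b _ => Subsingleton.elim a b⟩
  · refine Classical.choice (Function.Embedding.nonempty_of_card_le ?_)
    simpa using hlt

theorem PP.two {s t : ℕ} {V : Type} {H : SimpleGraph V} (hP : PP s t H) (hs : 2 ≤ s) (ht : 2 ≤ t)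
    (S₁ S₂ : Set V) (h₁ : (H.induce S₁).Connected) (h₂ : (H.induce S₂).Connected)
    (hd : Disjoint S₁ S₂) (T : Finset V)
    (hT₁ : ∀ x ∈ T, x ∉ S₁ ∧ ∃ y ∈ S₁, H.Adj y x)
    (hT₂ : ∀ x ∈ T, x ∉ S₂ ∧ ∃ y ∈ S₂, H.Adj y x) : T.card < t - 1 := by
  by_contra hlt
  push Not at hlt
  have hm : MinorOf (completeBipartiteGraph Bool T) H := by
    refine minor_mk (fun i => if i then S₁ else S₂) (fun x => {x.1}) ?_
      (fun x => conn_single H _) ?_ ?_ ?_ ?_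
    · rintro (_ | _) <;> simpa
    · rintro (_ | _) (_ | _) h <;> simp_all
      exact hd.symm
    · intro a b h
      exact Set.disjoint_singleton.2 (fun h' : a.1 = b.1 => h (Subtype.ext h'))
    · rintro (_ | _) b
      · simpa using (hT₂ b.1 b.2).1
      · simpa using (hT₁ b.1 b.2).1
    · rintro (_ | _) b
      · obtain ⟨y, hy, h⟩ := (hT₂ b.1 b.2).2
        exact ⟨y, by simpa using hy, b.1, rfl, h⟩
      · obtain ⟨y, hy, h⟩ := (hT₁ b.1 b.2).2
        exact ⟨y, by simpa using hy, b.1, rfl, h⟩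
  refine hP 2 (t-1) (by norm_num) hs (by omega) (by omega) (minor_sub ?_ ?_ hm)
  · exact (Fintype.equivOfCardEq (by simp) : Fin 2 ≃ Bool).toEmbedding
  · refine Classical.choice (Function.Embedding.nonempty_of_card_le ?_)
    simpa using hlt

/-- The component property gives minor-freeness of the join. -/
theorem join_free {s t : ℕ} {V : Type} [Fintype V] (hst : s ≤ t) (hs : 1 ≤ s)
    (G : SimpleGraph V) (K : Finset V) (hK : K.card = s - 1)
    (hP : PP s t (G.comap (Subtype.val : {v : V // v ∉ K} → V))) :
    ¬ MinorOf (completeBipartiteGraph (Fin s) (Fin t)) G := by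
  classical
  rintro ⟨φ, h1, h2, h3⟩
  let I : Finset (Fin s ⊕ Fin t) := Finset.univ.filter (fun x => ∀ y ∈ φ x, y ∉ K)
  let L : Finset (Fin s) := Finset.univ.filter (fun x => Sum.inl x ∈ I)
  let R : Finset (Fin t) := Finset.univ.filter (fun x => Sum.inr x ∈ I)
  have hI : Iᶜ.card ≤ s - 1 := by
    have : ∀ x : Fin s ⊕ Fin t, ∃ y, x ∈ Iᶜ → (y ∈ φ x ∧ y ∈ K) := by
      intro x
      by_cases hx : x ∈ Iᶜ
      · simp only [I, Finset.mem_compl, Finset.mem_filter, Finset.mem_univ, true_and] at hx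
        push Not at hx
        obtain ⟨y, hy, hy'⟩ := hx
        exact ⟨y, fun _ => ⟨hy, hy'⟩⟩
      · obtain ⟨y⟩ := (h1 x).nonempty
        exact ⟨y, fun h => absurd h hx⟩
    choose g hg using this
    rw [← hK]
    refine Finset.card_le_card_of_injOn g (fun x hx => (hg x hx).2) ?_
    intro x hx y hy hxy
    by_contra hne
    exact Set.disjoint_left.1 (h2 hne) (hg x hx).1 (hxy ▸ (hg y hy).1)
  have hLR : I = L.disjSum R := by
    ext x
    rcases x with x | x <;> simp [L, R, I]
  have hcard : I.card + Iᶜ.card = s + t := by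
    rw [Finset.card_add_card_compl]; simp
  rw [hLR, Finset.card_disjSum, ← hLR] at hcard
  have hLs : L.card ≤ s := by simpa using Finset.card_le_univ L
  have hRs : R.card ≤ t := by simpa using Finset.card_le_univ R
  have hm : MinorOf (completeBipartiteGraph L R) (G.comap (Subtype.val : {v : V // v ∉ K} → V)) := by
    have key : ∀ x : L ⊕ R, Sum.map (Subtype.val) (Subtype.val) x ∈ I := by
      rintro (x | x)
      · have := x.2
        simp only [L, Finset.mem_filter, Finset.mem_univ, true_and] at this
        exact this
      · have := x.2
        simp only [R, Finset.mem_filter, Finset.mem_univ, true_and] at this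
        exact this
    have hne : Nonempty {v : V // v ∉ K} := by
      have : 0 < L.card := by omega
      obtain ⟨x, hx⟩ := Finset.card_pos.1 this
      obtain ⟨y⟩ := (h1 (Sum.inl x)).nonempty
      have := key (Sum.inl ⟨x, hx⟩)
      simp only [I, Finset.mem_filter, Finset.mem_univ, true_and] at this
      exact ⟨⟨y.1, this y.1 y.2⟩⟩
    obtain ⟨v0⟩ := hne
    refine minor_map (G := G) {v | v ∉ K} (fun v => if h : v ∉ K then ⟨v, h⟩ else v0) ?_ ?_
      (fun x => φ (Sum.map (Subtype.val) (Subtype.val) x)) (fun a => h1 _) ?_ ?_ ?_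
    · intro x hx y hy hxy
      simp only [Set.mem_ofPred_eq] at hx hy
      simpa [hx, hy] using hxy
    · intro x hx y hy hxy
      simp only [Set.mem_ofPred_eq] at hx hy
      simpa [hx, hy] using hxy
    · intro a b hab
      exact h2 (fun h => hab (Sum.map_injective.2
        ⟨Subtype.val_injective, Subtype.val_injective⟩ h))
    · intro a b hab
      apply h3
      rcases a with a | a <;> rcases b with b | b <;> simp_all [completeBipartiteGraph]
    · intro a y hy
      have := key a
      simp only [I, Finset.mem_filter, Finset.mem_univ, true_and] at this
      exact this y hy
  refine hP L.card (t + 1 - L.card) (by omega) hLs (by omega) (by omega) (minor_sub ?_ ?_ hm)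
  · refine Classical.choice (Function.Embedding.nonempty_of_card_le ?_)
    simp
  · refine Classical.choice (Function.Embedding.nonempty_of_card_le ?_)
    simp
    omega

theorem free_join {s t : ℕ} {V : Type}
    (G : SimpleGraph V) (K : Finset V) (hK : K.card = s - 1)
    (hc : G.IsClique (↑K : Set V)) (hd : ∀ v : V, v ∉ K → ∀ u ∈ K, G.Adj u v)
    (hm : ¬ MinorOf (completeBipartiteGraph (Fin s) (Fin t)) G) :
    PP s t (G.comap (Subtype.val : {v : V // v ∉ K} → V)) := by
  classical
  intro a b ha has hb hab hmin
  apply hm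
  obtain ⟨φ, h1, h2, h3⟩ := hmin
  have e : K ≃ Fin (s - a) ⊕ Fin (a - 1) := Fintype.equivOfCardEq (by simp; omega)
  have hlt : ∀ i, ((e.symm i : K) : V) ∈ K := fun i => (e.symm i).2
  have hne : ∀ i j, i ≠ j → ((e.symm i : K) : V) ≠ e.symm j := by
    intro i j hij h
    exact hij (e.symm.injective (Subtype.ext h))
  have hm' : MinorOf (completeBipartiteGraph (Fin a ⊕ Fin (s-a)) (Fin b ⊕ Fin (a-1))) G := by
    have hcn : ∀ x, (G.induce (Subtype.val '' φ x)).Connected := fun x =>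
      conn_image (G := (G.comap (Subtype.val : {v : V // v ∉ K} → V)))
        Subtype.val (φ x) (fun _ _ _ _ h => h) (h1 x)
    have hdj : ∀ x y, x ≠ y → Disjoint (Subtype.val '' φ x) (Subtype.val '' φ y) := by
      intro x y hxy
      exact (Set.disjoint_image_iff Subtype.val_injective).2 (h2 hxy)
    have hdk : ∀ x i, Disjoint (Subtype.val '' φ x) {((e.symm i : K) : V)} := by
      intro x i
      rw [Set.disjoint_singleton_right]
      rintro ⟨y, _, hy⟩
      exact y.2 (hy ▸ hlt i)
    refine minor_mk
      (Sum.elim (fun i => Subtype.val '' φ (Sum.inl i)) (fun i => {((e.symm (Sum.inl i) : K) : V)}))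
      (Sum.elim (fun i => Subtype.val '' φ (Sum.inr i)) (fun i => {((e.symm (Sum.inr i) : K) : V)}))
      ?_ ?_ ?_ ?_ ?_ ?_
    · rintro (i | i)
      · exact hcn _
      · exact conn_single G _
    · rintro (i | i)
      · exact hcn _
      · exact conn_single G _
    · rintro (i | i) (j | j) hij
      · exact hdj _ _ (by simpa using hij)
      · exact hdk _ _
      · exact (hdk _ _).symm
      · exact Set.disjoint_singleton.2 (hne _ _ (fun h => hij (by simpa using h)))
    · rintro (i | i) (j | j) hij
      · exact hdj _ _ (by simpa using hij)
      · exact hdk _ _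
      · exact (hdk _ _).symm
      · exact Set.disjoint_singleton.2 (hne _ _ (fun h => hij (by simpa using h)))
    · rintro (i | i) (j | j)
      · exact hdj _ _ (by simp)
      · exact hdk _ _
      · exact (hdk _ _).symm
      · exact Set.disjoint_singleton.2 (hne _ _ (by simp))
    · rintro (i | i) (j | j)
      · obtain ⟨x, hx, y, hy, h⟩ := h3 (Sum.inl i) (Sum.inr j) (by simp [completeBipartiteGraph])
        exact ⟨x, ⟨x, hx, rfl⟩, y, ⟨y, hy, rfl⟩, h⟩
      · obtain ⟨x, hx⟩ := (h1 (Sum.inl i)).nonempty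
        exact ⟨x, ⟨x, hx, rfl⟩, _, rfl, (hd x x.2 _ (hlt _)).symm⟩
      · obtain ⟨x, hx⟩ := (h1 (Sum.inr j)).nonempty
        exact ⟨_, rfl, x, ⟨x, hx, rfl⟩, (hd x x.2 _ (hlt _))⟩
      · exact ⟨_, rfl, _, rfl, hc (hlt _) (hlt _) (hne _ _ (by simp))⟩
  refine minor_sub ?_ ?_ hm'
  · exact (Fintype.equivOfCardEq (by simp; omega) : Fin s ≃ Fin a ⊕ Fin (s-a)).toEmbedding
  · exact (Fintype.equivOfCardEq (by simp; omega) : Fin t ≃ Fin b ⊕ Fin (a-1)).toEmbedding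

end PartMinor

section PartSpectral
open Classical Matrix

/-- neighbour finset (classical) -/
noncomputable def NF {V : Type} [Fintype V] (G : SimpleGraph V) (v : V) : Finset V :=
  Finset.univ.filter (fun u => G.Adj v u)

theorem mem_NF {V : Type} [Fintype V] {G : SimpleGraph V} {v u : V} : u ∈ NF G v ↔ G.Adj v u := by
  simp [NF]

theorem sum_NF {V : Type} [Fintype V] {M : Type*} [AddCommMonoid M] (G : SimpleGraph V) (v : V)
    (f : V → M) : ∑ u ∈ NF G v, f u = ∑ u, if G.Adj v u then f u else 0 := by
  rw [NF, Finset.sum_filter]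

theorem adjMat_mulVec {V : Type} [Fintype V] (G : SimpleGraph V) (y : V → ℝ) (v : V) :
    (adjMat G *ᵥ y) v = ∑ u ∈ NF G v, y u := by
  rw [sum_NF]
  simp [adjMat, Matrix.mulVec, dotProduct, SimpleGraph.adjMatrix_apply]

theorem specRad_psd {V : Type} [Fintype V] [DecidableEq V] (G : SimpleGraph V) :
    (algebraMap ℝ (Matrix V V ℝ) (specRad G) - adjMat G).PosSemidef := by
  have hH : (algebraMap ℝ (Matrix V V ℝ) (specRad G) - adjMat G).IsHermitian := by
    apply Matrix.IsHermitian.sub _ (adjMat_herm G)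
    rw [Matrix.algebraMap_eq_diagonal]
    apply Matrix.isHermitian_diagonal
  rw [hH.posSemidef_iff_eigenvalues_nonneg]
  intro i
  have h := hH.eigenvalues_mem_spectrum_real i
  rw [← spectrum.singleton_sub_eq, (adjMat_herm G).spectrum_real_eq_range_eigenvalues] at h
  obtain ⟨a, ha, b, ⟨j, rfl⟩, hab⟩ := h
  rw [Set.mem_singleton_iff] at ha
  subst ha
  rw [← hab]
  have : (adjMat_herm G).eigenvalues j ≤ specRad G :=
    le_ciSup (f := (adjMat_herm G).eigenvalues) (Set.finite_range _).bddAbove j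
  simpa using this

theorem quad_form {V : Type} [Fintype V] [DecidableEq V] (G : SimpleGraph V) (ρ : ℝ) (y : V → ℝ) :
    star y ⬝ᵥ (algebraMap ℝ (Matrix V V ℝ) ρ - adjMat G) *ᵥ y =
    ρ * ∑ v, y v * y v - ∑ v, y v * ∑ u ∈ NF G v, y u := by
  rw [Matrix.sub_mulVec, dotProduct_sub, Matrix.algebraMap_eq_diagonal]
  simp only [dotProduct, adjMat_mulVec, Matrix.mulVec_diagonal, Finset.mul_sum]
  congr 1
  apply Finset.sum_congr rfl
  intro v _
  simp
  ring

theorem rayleigh_le {V : Type} [Fintype V] [DecidableEq V] (G : SimpleGraph V) (y : V → ℝ) :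
    ∑ v, y v * ∑ u ∈ NF G v, y u ≤ specRad G * ∑ v, y v * y v := by
  have := (specRad_psd G).dotProduct_mulVec_nonneg y
  rw [quad_form] at this
  linarith

theorem perron {V : Type} [Fintype V] [DecidableEq V] [Nonempty V] (G : SimpleGraph V) :
    ∃ x : V → ℝ, (∀ v, 0 ≤ x v) ∧ (∃ v, 0 < x v) ∧
      ∀ v, specRad G * x v = ∑ u ∈ NF G v, x u := by
  obtain ⟨i, hi⟩ := exists_eq_ciSup_of_finite (f := (adjMat_herm G).eigenvalues)
  have hz := (adjMat_herm G).mulVec_eigenvectorBasis i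
  have hne : (adjMat_herm G).eigenvectorBasis i ≠ 0 :=
    (adjMat_herm G).eigenvectorBasis.orthonormal.ne_zero i
  set z : V → ℝ := ⇑((adjMat_herm G).eigenvectorBasis i) with hzdef
  have hz' : ∀ v, ∑ u ∈ NF G v, z u = specRad G * z v := by
    intro v
    rw [← adjMat_mulVec, hz]
    simp [specRad, hi]
  refine ⟨fun v => |z v|, fun v => abs_nonneg _, ?_, ?_⟩
  · by_contra hcon
    push Not at hcon
    apply hne
    ext v
    have := hcon v
    simpa using this
  · have h1 : specRad G * ∑ v, |z v| * |z v| ≤ ∑ v, |z v| * ∑ u ∈ NF G v, |z u| := by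
      rw [Finset.mul_sum]
      apply Finset.sum_le_sum
      intro v _
      calc specRad G * (|z v| * |z v|) = z v * ∑ u ∈ NF G v, z u := by
            rw [hz', abs_mul_abs_self]; ring
        _ ≤ |z v * ∑ u ∈ NF G v, z u| := le_abs_self _
        _ = |z v| * |∑ u ∈ NF G v, z u| := abs_mul _ _
        _ ≤ _ := mul_le_mul_of_nonneg_left (Finset.abs_sum_le_sum_abs _ _) (abs_nonneg _)
    have h2 := rayleigh_le G (fun v => |z v|)
    have h3 := ((specRad_psd G).dotProduct_mulVec_zero_iff (fun v => |z v|)).1 (by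
      rw [quad_form]; linarith)
    intro v
    have h4 := congrFun h3 v
    rw [Matrix.sub_mulVec, Matrix.algebraMap_eq_diagonal] at h4
    simp only [Pi.sub_apply, Matrix.mulVec_diagonal, adjMat_mulVec, Pi.zero_apply] at h4
    simp at h4
    linarith

/-- replace the graph outside the dominating set `K` -/
def joinOn {V : Type} (K : Finset V) (H' : SimpleGraph {v : V // v ∉ K}) : SimpleGraph V where
  Adj u v := u ≠ v ∧ ∀ (hu : u ∉ K) (hv : v ∉ K), H'.Adj ⟨u, hu⟩ ⟨v, hv⟩
  symm := ⟨fun _ _ h => ⟨h.1.symm, fun hv hu => (h.2 hu hv).symm⟩⟩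
  loopless := ⟨fun _ h => h.1 rfl⟩

theorem joinOn_comap {V : Type} (K : Finset V) (H' : SimpleGraph {v : V // v ∉ K}) :
    (joinOn K H').comap Subtype.val = H' := by
  ext u v
  simp only [joinOn, SimpleGraph.comap_adj]
  constructor
  · intro h; exact h.2 u.2 v.2
  · intro h; exact ⟨fun h' => h.ne (Subtype.ext h'), fun _ _ => h⟩

theorem sum_split {V : Type} [Fintype V] (K : Finset V) [Fintype {v : V // v ∉ K}] (f : V → ℝ) :
    ∑ v, f v = ∑ u ∈ K, f u + ∑ u : {u // u ∉ K}, f u := by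
  rw [← Finset.sum_add_sum_compl K]
  congr 1
  apply Finset.sum_subtype
  simp

theorem sum_dom_out {V : Type} [Fintype V] (G : SimpleGraph V) (K : Finset V)
    [Fintype {v : V // v ∉ K}]
    (hd : ∀ v : V, v ∉ K → ∀ u ∈ K, G.Adj u v) (f : V → ℝ) (v : {v : V // v ∉ K}) :
    ∑ u ∈ NF G v, f u = ∑ u ∈ K, f u +
      ∑ u ∈ NF (G.comap (Subtype.val : {v : V // v ∉ K} → V)) v, f u := by
  rw [sum_NF, sum_NF, sum_split K]
  congr 1
  apply Finset.sum_congr rfl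
  intro u hu
  rw [if_pos (hd v v.2 u hu).symm]

theorem sum_dom_in {V : Type} [Fintype V] (G : SimpleGraph V) (K : Finset V)
    [Fintype {v : V // v ∉ K}]
    (hc : G.IsClique (↑K : Set V))
    (hd : ∀ v : V, v ∉ K → ∀ u ∈ K, G.Adj u v) (f : V → ℝ) (v : V) (hv : v ∈ K) :
    ∑ u ∈ NF G v, f u + f v = ∑ u ∈ K, f u + ∑ u : {u // u ∉ K}, f u := by
  rw [← sum_split K, add_comm]
  have : (Finset.univ : Finset V) = insert v (NF G v) := by
    ext u
    simp only [Finset.mem_univ, Finset.mem_insert, mem_NF, true_iff]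
    by_cases huv : u = v
    · exact Or.inl huv
    · right
      by_cases hu : u ∈ K
      · exact hc hv hu (Ne.symm huv)
      · exact hd u hu v hv
  rw [this, Finset.sum_insert]
  simp [mem_NF]

theorem spectral_principle {V : Type} [Fintype V] [DecidableEq V] (s t : ℕ) (hs : 2 ≤ s)
    (hst : s ≤ t) (G : SimpleGraph V) (K : Finset V) [Fintype {v : V // v ∉ K}]
    (hmax : ∀ G' : SimpleGraph V,
        ¬ MinorOf (completeBipartiteGraph (Fin s) (Fin t)) G' → specRad G' ≤ specRad G)
    (hK : K.card = s - 1) (hc : G.IsClique (↑K : Set V))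
    (hd : ∀ v : V, v ∉ K → ∀ u ∈ K, G.Adj u v) (hne : Nonempty {v : V // v ∉ K}) :
    ∃ (ρ : ℝ) (x : {v : V // v ∉ K} → ℝ), 0 < ρ ∧ (∀ v, 0 < x v) ∧
      (∀ v, ρ * x v = ((s - 1 : ℕ) : ℝ) +
        ∑ u ∈ NF (G.comap (Subtype.val : {v : V // v ∉ K} → V)) v, x u) ∧
      (ρ = ((s - 1 : ℕ) : ℝ) - 1 + ∑ v, x v) ∧
      ∀ H' : SimpleGraph {v : V // v ∉ K}, PP s t H' → ∀ y : {v : V // v ∉ K} → ℝ,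
        (∀ v, 0 ≤ y v) → (∀ v, ρ * y v ≤ ((s - 1 : ℕ) : ℝ) + ∑ u ∈ NF H' v, y u) →
        ∑ v, y v ≤ ∑ v, x v := by
  have hk : (1 : ℝ) ≤ ((s - 1 : ℕ) : ℝ) := by
    have : 1 ≤ s - 1 := by omega
    exact_mod_cast this
  set k : ℝ := ((s - 1 : ℕ) : ℝ) with hkdef
  have : Nonempty V := ⟨hne.some.1⟩
  obtain ⟨z, hz0, ⟨p, hp⟩, hz⟩ := perron G
  set ρ := specRad G with hρ
  have hρ0 : 0 ≤ ρ := by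
    have h1 : 0 ≤ ρ * z p := by
      rw [hz]; exact Finset.sum_nonneg (fun i _ => hz0 i)
    by_contra hneg
    push Not at hneg
    nlinarith
  have hKs : ∀ (c : ℝ), ∑ u ∈ K, c = k * c := by
    intro c
    rw [Finset.sum_const, hK, nsmul_eq_mul]
  have htot : 0 < ∑ u ∈ K, z u + ∑ u : {u // u ∉ K}, z u := by
    rw [← sum_split K]
    exact Finset.sum_pos' (fun i _ => hz0 i) ⟨p, Finset.mem_univ _, hp⟩
  set Tt := ∑ u ∈ K, z u + ∑ u : {u // u ∉ K}, z u with hTt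
  set c := Tt / (ρ + 1) with hcdef
  have hcpos : 0 < c := by positivity
  have hzK : ∀ v ∈ K, z v = c := by
    intro v hv
    have := sum_dom_in G K hc hd z v hv
    rw [← hz, ← hTt] at this
    rw [hcdef, eq_div_iff (by positivity)]
    linarith
  have hsK : ∑ u ∈ K, z u = k * c := by
    rw [← hKs]
    exact Finset.sum_congr rfl (fun u hu => hzK u hu)
  set x : {v : V // v ∉ K} → ℝ := fun v => z v / c with hx
  have hx0 : ∀ v, 0 ≤ x v := fun v => div_nonneg (hz0 _) hcpos.le
  have heq : ∀ v, ρ * x v = k +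
        ∑ u ∈ NF (G.comap (Subtype.val : {v : V // v ∉ K} → V)) v, x u := by
    intro v
    have := sum_dom_out G K hd z v
    rw [← hz, hsK] at this
    simp only [hx]
    rw [← Finset.sum_div]
    field_simp
    linarith
  have hpos : ∀ v, 0 < ρ * x v := by
    intro v
    rw [heq]
    have := Finset.sum_nonneg (s := NF (G.comap (Subtype.val : {v : V // v ∉ K} → V)) v)
      (fun u _ => hx0 u)
    linarith
  have hρpos : 0 < ρ := by
    rcases hρ0.lt_or_eq with h | h
    · exact h
    · have := hpos hne.some
      rw [← h] at this
      simp at this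
  have hsum : ρ = k - 1 + ∑ v, x v := by
    have : 0 < K.card := by omega
    obtain ⟨q, hq⟩ := Finset.card_pos.1 this
    have h1 := sum_dom_in G K hc hd z q hq
    rw [← hz, hzK q hq, hsK] at h1
    simp only [hx]
    rw [← Finset.sum_div]
    field_simp
    linarith
  refine ⟨ρ, x, hρpos, fun v => ?_, heq, hsum, ?_⟩
  · have := hpos v
    exact (pos_iff_pos_of_mul_pos this).1 hρpos
  · intro H' hP y hy0 hy
    by_contra hlt
    push Not at hlt
    have hfree := join_free hst (by omega) (joinOn K H') K hK (by rw [joinOn_comap]; exact hP)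
    have hle := hmax _ hfree
    obtain ⟨w, hw⟩ : ∃ w : V → ℝ, w = (fun v => if h : v ∉ K then y ⟨v, h⟩ else 1) := ⟨_, rfl⟩
    have hray := rayleigh_le (joinOn K H') w
    have hwK : ∀ v ∈ K, w v = 1 := fun v hv => by simp [hw, hv]
    have hwN : ∀ v : {v : V // v ∉ K}, w v = y v := fun v => by simp [hw, v.2]
    have hwKs : ∑ u ∈ K, w u = k := by
      rw [Finset.sum_congr rfl (fun u hu => hwK u hu), hKs]; ring
    have hwNs : ∑ u : {u // u ∉ K}, w u = ∑ v, y v := Finset.sum_congr rfl (fun u _ => hwN u)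
    have hcl : (joinOn K H').IsClique (↑K : Set V) := by
      intro u hu v hv huv
      exact ⟨huv, fun h => absurd hu h⟩
    have hdom : ∀ v : V, v ∉ K → ∀ u ∈ K, (joinOn K H').Adj u v := by
      intro v hv u hu
      exact ⟨fun h => hv (h ▸ hu), fun h => absurd hu h⟩
    have hin : ∀ v ∈ K, w v * ∑ u ∈ NF (joinOn K H') v, w u =
        k + ∑ v, y v - 1 := by
      intro v hv
      have := sum_dom_in (joinOn K H') K hcl hdom w v hv
      rw [hwKs, hwNs, hwK v hv] at this
      rw [hwK v hv]
      linarith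
    have hout : ∀ v : {v // v ∉ K}, ρ * (w v * w v) ≤ w v * ∑ u ∈ NF (joinOn K H') v, w u := by
      intro v
      rw [sum_dom_out (joinOn K H') K hdom w v, hwKs, hwN, joinOn_comap]
      rw [Finset.sum_congr rfl (fun u _ => hwN u)]
      have := mul_le_mul_of_nonneg_left (hy v) (hy0 v)
      linarith
    have hww : 0 ≤ ∑ v, w v * w v := Finset.sum_nonneg (fun v _ => mul_self_nonneg _)
    have h1 : ∑ v, w v * ∑ u ∈ NF (joinOn K H') v, w u ≤ ρ * ∑ v, w v * w v :=
      hray.trans (mul_le_mul_of_nonneg_right hle hww)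
    rw [sum_split K, sum_split K (fun v => w v * w v),
      Finset.sum_congr rfl hin, hKs,
      Finset.sum_congr rfl (fun v hv => by rw [hwK v hv] :
        ∀ v ∈ K, w v * w v = 1 * 1), hKs] at h1
    have h2 := Finset.sum_le_sum (fun (v : {v // v ∉ K}) (_ : v ∈ Finset.univ) => hout v)
    rw [← Finset.mul_sum] at h2
    nlinarith

end PartSpectral

section PartLex
open Classical

/-- classical degree -/
noncomputable def dg {V : Type} [Fintype V] (H : SimpleGraph V) (v : V) : ℕ := (NF H v).card

theorem PP.dg_lt {s t : ℕ} {V : Type} [Fintype V] {H : SimpleGraph V} (hP : PP s t H)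
    (hs : 1 ≤ s) (ht : 1 ≤ t) (v : V) : dg H v < t := by
  apply hP.star hs ht {v} (conn_single H v)
  intro x hx
  rw [mem_NF] at hx
  exact ⟨fun h => hx.ne (by simpa using h.symm), v, rfl, hx⟩

theorem sum_swap {V : Type} [Fintype V] (H : SimpleGraph V) (A : Finset V)
    (hA : ∀ u ∈ A, ∀ v, H.Adj u v → v ∈ A) (f : V → ℝ) :
    ∑ v ∈ A, ∑ u ∈ NF H v, f u = ∑ u ∈ A, (dg H u : ℝ) * f u := by
  rw [Finset.sum_comm' (t' := A) (s' := fun u => NF H u)]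
  · apply Finset.sum_congr rfl
    intro u _
    rw [Finset.sum_const, nsmul_eq_mul, dg]
  · intro v u
    simp only [mem_NF]
    constructor
    · rintro ⟨h1, h2⟩; exact ⟨h2.symm, hA v h1 u h2⟩
    · rintro ⟨h1, h2⟩; exact ⟨hA u h2 v h1, h1.symm⟩

/-- abstract form of the extremality of the graph outside of `K` -/
structure ExtG (s t : ℕ) {V : Type} [Fintype V] (H : SimpleGraph V) (ρ k : ℝ) (x : V → ℝ) :
    Prop where
  hP : PP s t H
  hs : 2 ≤ s
  ht : 4 ≤ t
  hk : 1 ≤ k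
  hρ : 0 < ρ
  hx : ∀ v, 0 < x v
  heq : ∀ v, ρ * x v = k + ∑ u ∈ NF H v, x u
  hmax : ∀ H' : SimpleGraph V, PP s t H' → ∀ y : V → ℝ, (∀ v, 0 ≤ y v) →
    (∀ v, ρ * y v ≤ k + ∑ u ∈ NF H' v, y u) → ∑ v, y v ≤ ∑ v, x v

theorem sum_NF_comap {V W : Type} [Fintype V] [Fintype W] (J : SimpleGraph W) (e : V ≃ W)
    (f : W → ℝ) (v : V) : ∑ u ∈ NF (J.comap e) v, f (e u) = ∑ w ∈ NF J (e v), f w := by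
  rw [sum_NF, sum_NF, ← e.sum_comp]
  rfl

/-- disjoint copies of a graph together with isolated vertices -/
def cpIso (p q : ℕ) {X : Type} (Q : SimpleGraph X) : SimpleGraph ((Fin p × X) ⊕ Fin q) where
  Adj a b := ∃ i x y, a = Sum.inl (i, x) ∧ b = Sum.inl (i, y) ∧ Q.Adj x y
  symm := ⟨by rintro _ _ ⟨i, x, y, rfl, rfl, h⟩; exact ⟨i, y, x, rfl, rfl, h.symm⟩⟩
  loopless := ⟨by
    rintro _ ⟨i, x, y, rfl, h, h'⟩
    simp only [Sum.inl.injEq, Prod.mk.injEq, true_and] at h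
    exact h'.ne h⟩

theorem def_bound {s t : ℕ} {V : Type} [Fintype V] {H : SimpleGraph V} {ρ k : ℝ} {x : V → ℝ}
    (E : ExtG s t H ρ k x) (hρt : (t : ℝ) ≤ ρ) :
    ∑ v, ((t : ℝ) - 1 - dg H v) ≤ t * (t - 1) := by
  have hk := E.hk
  have hρ := E.hρ
  have ht : (4 : ℝ) ≤ t := by exact_mod_cast E.ht
  set N := Fintype.card V with hN
  set p := N / t
  set q := N % t
  have hNpq : N = p * t + q := (Nat.div_add_mod' N t).symm
  have hq : q < t := Nat.mod_lt _ (by have := E.ht; omega)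
  have e : V ≃ (Fin p × Fin t) ⊕ Fin q := Fintype.equivOfCardEq (by simp [← hN, hNpq])
  let J := cpIso p q (⊤ : SimpleGraph (Fin t))
  let a : ℝ := k / (ρ - (t - 1))
  let b : ℝ := k / ρ
  have hd : 0 < ρ - (t - 1) := by linarith
  have ha : a * (ρ - (t - 1)) = k := div_mul_cancel₀ _ hd.ne'
  have hb : b * ρ = k := div_mul_cancel₀ _ hρ.ne'
  have ha0 : 0 ≤ a := by positivity
  have hb0 : 0 ≤ b := by positivity
  let f : (Fin p × Fin t) ⊕ Fin q → ℝ := Sum.elim (fun _ => a) (fun _ => b)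
  have hf0 : ∀ w, 0 ≤ f w := by rintro (w | w) <;> simp [f, ha0, hb0]
  have hJP : PP s t J := by
    refine PP.of_labels (Sum.elim (fun w => some w.1) (fun _ => none)) ?_ ?_
    · rintro _ _ ⟨i, x, y, rfl, rfl, h⟩; rfl
    · intro i
      refine ⟨Fin t, ⊤, Sum.elim (fun w => w.2) (fun w => ⟨w, w.2.trans hq⟩),
        PP.of_card (by simp), ?_, ?_⟩
      · rintro (⟨u, u'⟩ | u) hu (⟨v, v'⟩ | v) hv huv
        · simp only [Set.mem_ofPred_eq, Sum.elim_inl] at hu hv huv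
          have h1 : some u = some v := hu.trans hv.symm
          rw [Option.some.inj h1, huv]
        · simp only [Set.mem_ofPred_eq, Sum.elim_inl, Sum.elim_inr] at hu hv huv
          simp [← hv] at hu
        · simp only [Set.mem_ofPred_eq, Sum.elim_inl, Sum.elim_inr] at hu hv huv
          simp [← hv] at hu
        · simp only [Sum.elim_inr, Fin.mk.injEq] at huv
          rw [Fin.ext huv]
      · rintro _ _ _ _ ⟨i, x, y, rfl, rfl, h⟩
        exact h
  have hmain := E.hmax (J.comap e) (hJP.of_inj e e.injective (fun _ _ h => h)) (fun v => f (e v))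
    (fun v => hf0 _) (by
      intro v
      rw [sum_NF_comap J e f v]
      rcases h : e v with ⟨i, c⟩ | c
      · have hsub : ((Finset.univ : Finset (Fin t)).erase c).image
            (fun d => (Sum.inl (i, d) : (Fin p × Fin t) ⊕ Fin q)) ⊆ NF J (Sum.inl (i, c)) := by
          intro w hw
          simp only [Finset.mem_image, Finset.mem_erase, Finset.mem_univ, and_true] at hw
          obtain ⟨d, hd, rfl⟩ := hw
          rw [mem_NF]
          exact ⟨i, c, d, rfl, rfl, hd.symm⟩
        have h1 := Finset.sum_le_sum_of_subset_of_nonneg hsub (fun w _ _ => hf0 w)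
        rw [Finset.sum_image (by intro x _ y _ h; simpa using h)] at h1
        simp only [f, Sum.elim_inl] at h1 ⊢
        rw [Finset.sum_const, Finset.card_erase_of_mem (Finset.mem_univ _)] at h1
        simp only [Finset.card_univ, Fintype.card_fin, nsmul_eq_mul] at h1
        rw [Nat.cast_sub (by have := E.ht; omega), Nat.cast_one] at h1
        linarith
      · have := Finset.sum_nonneg (s := NF J (Sum.inr c)) (fun w _ => hf0 w)
        simp only [f, Sum.elim_inr] at this ⊢
        linarith)
  rw [e.sum_comp f] at hmain
  simp only [f, Fintype.sum_sum_type, Sum.elim_inl, Sum.elim_inr, Finset.sum_const,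
    Finset.card_univ, Fintype.card_prod, Fintype.card_fin, nsmul_eq_mul] at hmain
  -- upper bound
  have hup : ∑ v, ρ * x v = ∑ v, (k + (dg H v : ℝ) * x v) := by
    rw [Finset.sum_congr rfl (fun v _ => E.heq v), Finset.sum_add_distrib, Finset.sum_add_distrib,
      sum_swap H Finset.univ (fun _ _ _ _ => Finset.mem_univ _)]
  have hxl : ∀ v, b ≤ x v := by
    intro v
    have := Finset.sum_nonneg (s := NF H v) (fun u _ => (E.hx u).le)
    have h2 := E.heq v
    have : b * ρ ≤ x v * ρ := by linarith
    exact le_of_mul_le_mul_right this hρ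
  have hdl : ∀ v, (dg H v : ℝ) ≤ t - 1 := by
    intro v
    have := E.hP.dg_lt (by have := E.hs; omega) (by have := E.ht; omega) v
    have : dg H v + 1 ≤ t := this
    have : ((dg H v + 1 : ℕ) : ℝ) ≤ t := by exact_mod_cast this
    push_cast at this
    linarith
  have h3 : ∑ v, ((t : ℝ) - 1 - dg H v) * b ≤ ∑ v, ((t : ℝ) - 1 - dg H v) * x v :=
    Finset.sum_le_sum (fun v _ => mul_le_mul_of_nonneg_left (hxl v) (by linarith [hdl v]))
  rw [← Finset.sum_mul] at h3
  have h4 : (ρ - (t - 1)) * ∑ v, x v = N * k - ∑ v, ((t : ℝ) - 1 - dg H v) * x v := by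
    rw [Finset.sum_add_distrib, Finset.sum_const, Finset.card_univ, nsmul_eq_mul,
      ← Finset.mul_sum] at hup
    simp only [sub_mul, Finset.sum_sub_distrib, ← Finset.mul_sum]
    linarith
  have h5 : (ρ - (t - 1)) * (((p * t : ℕ) : ℝ) * a + q * b) ≤
    N * k - (∑ v, ((t : ℝ) - 1 - dg H v)) * b := by
    have := mul_le_mul_of_nonneg_left hmain hd.le
    push_cast at this ⊢
    linarith
  have h6 : (N : ℝ) = ((p * t : ℕ) : ℝ) + q := by exact_mod_cast hNpq
  have hbpos : 0 < b := by positivity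
  have h7 : (∑ v, ((t : ℝ) - 1 - dg H v)) * b ≤ (q * (t - 1)) * b := by
    rw [h6] at h5
    have e1 : (ρ - (t - 1)) * (((p * t : ℕ) : ℝ) * a + q * b) =
      ((p * t : ℕ) : ℝ) * k + q * (k - (t-1) * b) := by
      linear_combination ((p * t : ℕ) : ℝ) * ha + (q:ℝ) * hb
    rw [e1] at h5
    linarith
  have h8 := le_of_mul_le_mul_right h7 hbpos
  have hq' : (q : ℝ) ≤ t := by exact_mod_cast hq.le
  nlinarith

end PartLex

section PartLexB
open Classical

/-- two step walk count -/
noncomputable def w2 {V : Type} [Fintype V] (H : SimpleGraph V) (v : V) : ℝ :=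
  ∑ u ∈ NF H v, (dg H u : ℝ)

/-- three step walk count -/
noncomputable def w3 {V : Type} [Fintype V] (H : SimpleGraph V) (v : V) : ℝ :=
  ∑ u ∈ NF H v, w2 H u

theorem w2_nonneg {V : Type} [Fintype V] (H : SimpleGraph V) (v : V) : 0 ≤ w2 H v :=
  Finset.sum_nonneg (fun _ _ => Nat.cast_nonneg _)

theorem w3_nonneg {V : Type} [Fintype V] (H : SimpleGraph V) (v : V) : 0 ≤ w3 H v :=
  Finset.sum_nonneg (fun _ _ => w2_nonneg _ _)

theorem sum_NF_le {V : Type} [Fintype V] (H : SimpleGraph V) (v : V) (f : V → ℝ) (c b : ℝ)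
    (hb : 0 ≤ b) (hd : (dg H v : ℝ) ≤ c) (hf : ∀ u, f u ≤ b) : ∑ u ∈ NF H v, f u ≤ c * b := by
  have := Finset.sum_le_card_nsmul (NF H v) f b (fun u _ => hf u)
  rw [nsmul_eq_mul] at this
  exact this.trans (mul_le_mul_of_nonneg_right hd hb)

theorem ExtG.dgle {s t : ℕ} {V : Type} [Fintype V] {H : SimpleGraph V} {ρ k : ℝ} {x : V → ℝ}
    (E : ExtG s t H ρ k x) (v : V) : (dg H v : ℝ) ≤ t := by
  have := E.hP.dg_lt (by have := E.hs; omega) (by have := E.ht; omega) v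
  exact_mod_cast this.le

theorem ExtG.upper {s t : ℕ} {V : Type} [Fintype V] {H : SimpleGraph V} {ρ k : ℝ} {x : V → ℝ}
    (E : ExtG s t H ρ k x) (hρ : 2 * (t : ℝ) ≤ ρ) (r : ℝ) (hr : r * ρ = 1) (v : V) :
    x v ≤ k * (r + dg H v * r ^ 2 + w2 H v * r ^ 3 + 2 * t ^ 3 * r ^ 4) := by
  have hk := E.hk
  have hρ0 := E.hρ
  have hr0 : 0 < r := pos_of_mul_pos_left (by rw [hr]; exact one_pos) hρ0.le
  have heq : ∀ v, x v = r * k + r * ∑ u ∈ NF H v, x u := by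
    intro v
    have := E.heq v
    calc x v = (r * ρ) * x v := by rw [hr, one_mul]
      _ = r * (ρ * x v) := by ring
      _ = _ := by rw [this]; ring
  have h0 : ∀ v, x v ≤ 2 * k * r := by
    obtain ⟨m, -, hm⟩ := Finset.exists_max_image Finset.univ x ⟨v, Finset.mem_univ v⟩
    have h1 := sum_NF_le H m x t (x m) (E.hx m).le (E.dgle m) (fun u => hm u (Finset.mem_univ u))
    have h2 := E.heq m
    have h3 : 2 * t * x m ≤ ρ * x m := mul_le_mul_of_nonneg_right hρ (E.hx m).le
    have h4 : ρ * x m ≤ 2 * k := by linarith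
    have h5 : r * (ρ * x m) ≤ r * (2 * k) := mul_le_mul_of_nonneg_left h4 hr0.le
    have h6 : r * (ρ * x m) = x m := by rw [← mul_assoc, hr, one_mul]
    intro u
    have := hm u (Finset.mem_univ u)
    linarith
  have h1 : ∀ v, x v ≤ k * r + dg H v * (2 * k * r ^ 2) := by
    intro v
    have h := sum_NF_le H v x (dg H v) (2 * k * r) (by positivity) le_rfl h0
    have := mul_le_mul_of_nonneg_left h hr0.le
    rw [heq v]
    nlinarith
  have h2 : ∀ v, x v ≤ k * r + k * dg H v * r ^ 2 + 2 * k * w2 H v * r ^ 3 := by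
    intro v
    have h : ∑ u ∈ NF H v, x u ≤ ∑ u ∈ NF H v, (k * r + dg H u * (2 * k * r ^ 2)) :=
      Finset.sum_le_sum (fun u _ => h1 u)
    rw [Finset.sum_add_distrib, Finset.sum_const, nsmul_eq_mul, ← Finset.sum_mul] at h
    have := mul_le_mul_of_nonneg_left h hr0.le
    rw [heq v]
    simp only [w2, dg] at *
    linarith
  have h3 : ∀ v, x v ≤ k * r + k * dg H v * r ^ 2 + k * w2 H v * r ^ 3 + 2 * k * w3 H v * r ^ 4 := by
    intro v
    have h : ∑ u ∈ NF H v, x u ≤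
      ∑ u ∈ NF H v, (k * r + dg H u * (k * r ^ 2) + w2 H u * (2 * k * r ^ 3)) :=
      Finset.sum_le_sum (fun u _ => (h2 u).trans (le_of_eq (by ring)))
    rw [Finset.sum_add_distrib, Finset.sum_add_distrib, Finset.sum_const, nsmul_eq_mul,
      ← Finset.sum_mul, ← Finset.sum_mul] at h
    have := mul_le_mul_of_nonneg_left h hr0.le
    rw [heq v]
    change r * ∑ u ∈ NF H v, x u ≤ r * ((dg H v : ℝ) * (k * r) + w2 H v * (k * r ^ 2) +
      w3 H v * (2 * k * r ^ 3)) at this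
    linarith
  have hw2 : ∀ v, w2 H v ≤ t * t := fun v =>
    sum_NF_le H v _ t t (by positivity) (E.dgle v) (fun u => E.dgle u)
  have hw3 : w3 H v ≤ t * (t * t) :=
    sum_NF_le H v _ t _ (by positivity) (E.dgle v) hw2
  have h4 : w3 H v * (2 * k * r ^ 4) ≤ t * (t * t) * (2 * k * r ^ 4) :=
    mul_le_mul_of_nonneg_right hw3 (by positivity)
  have := h3 v
  nlinarith

theorem sum_w2 {V : Type} [Fintype V] (H : SimpleGraph V) (A : Finset V)
    (hA : ∀ u ∈ A, ∀ v, H.Adj u v → v ∈ A) :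
    ∑ v ∈ A, w2 H v = ((∑ v ∈ A, dg H v ^ 2 : ℕ) : ℝ) := by
  unfold w2
  rw [sum_swap H A hA]
  push_cast
  exact Finset.sum_congr rfl (fun u _ => by ring)

theorem lex_real {s t : ℕ} {V : Type} [Fintype V] {H : SimpleGraph V} {ρ k : ℝ} {x : V → ℝ}
    (E : ExtG s t H ρ k x) (A : Finset V) (hA : ∀ u ∈ A, ∀ v, H.Adj u v → v ∈ A)
    {W : Type} [Fintype W] (B : SimpleGraph W) (hB : PP s t B) (hc : Fintype.card W = A.card)
    (hρ : 2 * (t : ℝ) ≤ ρ) :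
    ((∑ w, dg B w : ℕ) : ℝ) * ρ ^ 2 + ((∑ w, dg B w ^ 2 : ℕ) : ℝ) * ρ ≤
    ((∑ v ∈ A, dg H v : ℕ) : ℝ) * ρ ^ 2 + ((∑ v ∈ A, dg H v ^ 2 : ℕ) : ℝ) * ρ +
      A.card * (2 * t ^ 3) := by
  have hk := E.hk
  have hρ0 := E.hρ
  obtain ⟨r, hr⟩ : ∃ r, r * ρ = 1 := ⟨ρ⁻¹, inv_mul_cancel₀ hρ0.ne'⟩
  have hr0 : 0 < r := pos_of_mul_pos_left (by rw [hr]; exact one_pos) hρ0.le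
  have e : {v // v ∈ A} ≃ W := Fintype.equivOfCardEq (by simp [hc])
  let H' : SimpleGraph V :=
    { Adj := fun u v => (u ∉ A ∧ v ∉ A ∧ H.Adj u v) ∨
        ∃ hu hv, B.Adj (e ⟨u, hu⟩) (e ⟨v, hv⟩)
      symm := ⟨by
        rintro u v (⟨h1, h2, h3⟩ | ⟨hu, hv, h⟩)
        · exact Or.inl ⟨h2, h1, h3.symm⟩
        · exact Or.inr ⟨hv, hu, h.symm⟩⟩
      loopless := ⟨by
        rintro u (⟨h1, h2, h3⟩ | ⟨hu, hv, h⟩)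
        · exact h3.ne rfl
        · exact h.ne rfl⟩ }
  have hH' : PP s t H' := by
    refine PP.of_labels (fun v => decide (v ∈ A)) ?_ ?_
    · rintro u v (⟨h1, h2, h3⟩ | ⟨hu, hv, h⟩)
      · simp [h1, h2]
      · simp [hu, hv]
    · rintro (_ | _)
      · refine ⟨V, H, id, E.hP, Function.injective_id.injOn, ?_⟩
        rintro u v h1 h2 (⟨_, _, h⟩ | ⟨hu, hv, h⟩)
        · exact h
        · simp [hu] at h1
      · by_cases hne : Nonempty {v // v ∈ A}
        · refine ⟨W, B, fun v => if h : v ∈ A then e ⟨v, h⟩ else e (Classical.choice hne), hB,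
            ?_, ?_⟩
          · intro u hu v hv huv
            have hu : u ∈ A := by simpa using hu
            have hv : v ∈ A := by simpa using hv
            simp only [hu, hv, dif_pos] at huv
            simpa using e.injective huv
          · rintro u v h1 h2 (⟨_, _, h⟩ | ⟨hu, hv, h⟩)
            · simp_all
            · simpa only [hu, hv, dif_pos] using h
        · have hno : ∀ v, v ∉ A := fun v hv => hne ⟨⟨v, hv⟩⟩
          refine ⟨V, H, id, E.hP, Function.injective_id.injOn, ?_⟩
          intro u v h1
          exact absurd (by simpa using h1) (hno u)
  let f : W → ℝ := fun w => k * (r + dg B w * r ^ 2 + w2 B w * r ^ 3)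
  have hf0 : ∀ w, 0 ≤ f w := fun w => by
    have := w2_nonneg B w
    simp only [f]
    positivity
  let y : V → ℝ := fun v => if h : v ∈ A then f (e ⟨v, h⟩) else x v
  have hy0 : ∀ v, 0 ≤ y v := by
    intro v
    simp only [y]
    split_ifs
    · exact hf0 _
    · exact (E.hx v).le
  have hysub : ∀ v, ρ * y v ≤ k + ∑ u ∈ NF H' v, y u := by
    intro v
    by_cases hv : v ∈ A
    · have hNF : NF H' v = (NF B (e ⟨v, hv⟩)).image (fun w => (e.symm w).1) := by
        ext u
        simp only [mem_NF, Finset.mem_image]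
        constructor
        · rintro (⟨h1, h2, h3⟩ | ⟨hu, hv, h⟩)
          · exact absurd hv h1
          · exact ⟨_, h, by simp⟩
        · rintro ⟨w, hw, rfl⟩
          exact Or.inr ⟨hv, (e.symm w).2, by simpa using hw⟩
      rw [hNF, Finset.sum_image (fun a _ b _ h => e.symm.injective (Subtype.ext h))]
      have h1 : ∀ w, y (e.symm w).1 = f w := by
        intro w
        simp [y]
      simp only [h1]
      have h2 : y v = f (e ⟨v, hv⟩) := by simp [y, hv]
      rw [h2]
      set w := e ⟨v, hv⟩
      have h3 : ∑ u ∈ NF B w, f u = k * (dg B w * r + w2 B w * r ^ 2 + w3 B w * r ^ 3) := by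
        simp only [f]
        rw [← Finset.mul_sum, Finset.sum_add_distrib, Finset.sum_add_distrib, Finset.sum_const,
          nsmul_eq_mul, ← Finset.sum_mul, ← Finset.sum_mul]
        rfl
      rw [h3]
      have h4 : ρ * f w = k * (1 + dg B w * r + w2 B w * r ^ 2) := by
        simp only [f]
        linear_combination (k * (1 + dg B w * r + w2 B w * r ^ 2)) * hr
      rw [h4]
      have h5 : 0 ≤ k * (w3 B w * r ^ 3) := by
        have := w3_nonneg B w
        positivity
      linarith
    · have hNF : NF H' v = NF H v := by
        ext u
        simp only [mem_NF]
        constructor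
        · rintro (⟨h1, h2, h3⟩ | ⟨hu, hv, h⟩)
          · exact h3
          · exact absurd hu ‹_›
        · intro h
          exact Or.inl ⟨hv, fun hu => hv (hA u hu v h.symm), h⟩
      rw [hNF]
      have h1 : ∑ u ∈ NF H v, y u = ∑ u ∈ NF H v, x u := by
        apply Finset.sum_congr rfl
        intro u hu
        rw [mem_NF] at hu
        have : u ∉ A := fun hu' => hv (hA u hu' v hu.symm)
        simp [y, this]
      rw [h1, ← E.heq v]
      simp [y, hv]
  have hmain := E.hmax H' hH' y hy0 hysub
  rw [← Finset.sum_add_sum_compl A y, ← Finset.sum_add_sum_compl A x] at hmain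
  have hcompl : ∑ v ∈ Aᶜ, y v = ∑ v ∈ Aᶜ, x v := by
    apply Finset.sum_congr rfl
    intro u hu
    have : u ∉ A := by simpa using hu
    simp [y, this]
  have hyA : ∑ v ∈ A, y v = ∑ w, f w := by
    rw [← Finset.sum_coe_sort A, ← e.sum_comp]
    apply Finset.sum_congr rfl
    intro u _
    simp [y]
  have hxA : ∑ v ∈ A, x v ≤
      ∑ v ∈ A, k * (r + dg H v * r ^ 2 + w2 H v * r ^ 3 + 2 * t ^ 3 * r ^ 4) :=
    Finset.sum_le_sum (fun v _ => E.upper hρ r hr v)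
  have hWB := sum_w2 B Finset.univ (fun _ _ _ _ => Finset.mem_univ _)
  have hWA := sum_w2 H A hA
  have h1 : ∑ w, f w ≤ ∑ v ∈ A, k * (r + dg H v * r ^ 2 + w2 H v * r ^ 3 + 2 * t ^ 3 * r ^ 4) := by
    linarith
  simp only [f] at h1
  rw [← Finset.mul_sum, ← Finset.mul_sum] at h1
  have h2 := le_of_mul_le_mul_left h1 (by linarith)
  simp only [Finset.sum_add_distrib, Finset.sum_const, Finset.card_univ, hc, nsmul_eq_mul] at h2
  simp only [← Finset.sum_mul] at h2
  rw [hWB, hWA, ← Nat.cast_sum, ← Nat.cast_sum] at h2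
  have h3 := mul_le_mul_of_nonneg_right h2 (show 0 ≤ ρ ^ 4 by positivity)
  have e2 : r ^ 2 * ρ ^ 4 = ρ ^ 2 := by
    calc r ^ 2 * ρ ^ 4 = (r * ρ) ^ 2 * ρ ^ 2 := by ring
      _ = _ := by rw [hr]; ring
  have e3 : r ^ 3 * ρ ^ 4 = ρ := by
    calc r ^ 3 * ρ ^ 4 = (r * ρ) ^ 3 * ρ := by ring
      _ = _ := by rw [hr]; ring
  have e4 : r ^ 4 * ρ ^ 4 = 1 := by
    calc r ^ 4 * ρ ^ 4 = (r * ρ) ^ 4 := by ring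
      _ = _ := by rw [hr]; ring
  simp only [add_mul, mul_assoc, e2, e3, e4] at h3
  linarith

theorem lex {s t : ℕ} {V : Type} [Fintype V] {H : SimpleGraph V} {ρ k : ℝ} {x : V → ℝ}
    (E : ExtG s t H ρ k x) (A : Finset V) (hA : ∀ u ∈ A, ∀ v, H.Adj u v → v ∈ A)
    {W : Type} [Fintype W] (B : SimpleGraph W) (hB : PP s t B) (hc : Fintype.card W = A.card)
    (hρ : 4 * (A.card : ℝ) * t ^ 3 + 2 * t ≤ ρ) :
    (∑ w, dg B w ≤ ∑ v ∈ A, dg H v) ∧ (∑ w, dg B w = ∑ v ∈ A, dg H v →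
      ∑ w, dg B w ^ 2 ≤ ∑ v ∈ A, dg H v ^ 2) := by
  have ht : (4 : ℝ) ≤ t := by exact_mod_cast E.ht
  have hM : (0 : ℝ) ≤ A.card := Nat.cast_nonneg _
  have hMt : (0 : ℝ) ≤ A.card * t ^ 3 := by positivity
  have h := lex_real E A hA B hB hc (by linarith)
  have hρ0 := E.hρ
  have hsm : A.card * (2 * (t : ℝ) ^ 3) < ρ := by linarith
  have hW2 : ((∑ v ∈ A, dg H v ^ 2 : ℕ) : ℝ) ≤ A.card * t ^ 2 := by
    push_cast
    have := Finset.sum_le_card_nsmul A (fun v => (dg H v : ℝ) ^ 2) (t ^ 2)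
      (fun v _ => pow_le_pow_left₀ (Nat.cast_nonneg _) (E.dgle v) 2)
    rwa [nsmul_eq_mul] at this
  constructor
  · by_contra hlt
    push Not at hlt
    have h1 : ((∑ v ∈ A, dg H v : ℕ) : ℝ) + 1 ≤ ((∑ w, dg B w : ℕ) : ℝ) := by exact_mod_cast hlt
    have h2 := mul_le_mul_of_nonneg_right h1 (show 0 ≤ ρ ^ 2 by positivity)
    have h3 := mul_le_mul_of_nonneg_right hW2 hρ0.le
    have h4 : 0 ≤ ((∑ w, dg B w ^ 2 : ℕ) : ℝ) * ρ := by positivity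
    have h5 : ρ * ρ ≤ (A.card * t ^ 2 + 1) * ρ := by nlinarith
    have h6 := le_of_mul_le_mul_right h5 hρ0
    have h7 : (A.card : ℝ) * t ^ 2 ≤ A.card * t ^ 3 :=
      mul_le_mul_of_nonneg_left (pow_le_pow_right₀ (by linarith) (by norm_num)) hM
    linarith
  · intro heq
    by_contra hlt
    push Not at hlt
    have h1 : ((∑ v ∈ A, dg H v ^ 2 : ℕ) : ℝ) + 1 ≤ ((∑ w, dg B w ^ 2 : ℕ) : ℝ) := by
      exact_mod_cast hlt
    have h2 := mul_le_mul_of_nonneg_right h1 hρ0.le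
    rw [heq] at h
    linarith

end PartLexB

section PartLoc
open Classical

theorem loc {s t : ℕ} {V : Type} [Fintype V] {H : SimpleGraph V} (hP : PP s t H)
    (hs : 2 ≤ s) (ht : 4 ≤ t) (v : V) (hv : dg H v = t - 1)
    (h2 : ∀ w z, H.Adj v w → H.Adj w z → dg H z = t - 1)
    (h3 : ∀ w z y, H.Adj v w → H.Adj w z → H.Adj z y → dg H y = t - 1) :
    ∀ u ∈ insert v (NF H v), ∀ w, H.Adj u w → w ∈ insert v (NF H v) := by
  have hs1 : 1 ≤ s := by omega
  have ht1 : 1 ≤ t := by omega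
  have ht2 : 2 ≤ t := by omega
  intro w hw z hwz
  by_contra hzS
  have hmem : ∀ a, a ∉ insert v (NF H v) → a ≠ v ∧ ¬ H.Adj v a := by
    intro a ha
    simpa [mem_NF] using ha
  obtain ⟨hzv, hzn⟩ := hmem z hzS
  have hvw : H.Adj v w := by
    rcases Finset.mem_insert.1 hw with rfl | h
    · exact absurd hwz hzn
    · exact mem_NF.1 h
  have hcardE : ∀ w', H.Adj v w' → ((NF H v).erase w').card = t - 2 := by
    intro w' hw'
    rw [Finset.card_erase_of_mem (mem_NF.2 hw')]
    have : (NF H v).card = t - 1 := hv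
    omega
  have cpair : ∀ w', H.Adj v w' → (H.induce {w', v}).Connected := fun w' hw' =>
    conn_insert (conn_single H v) rfl hw'.symm
  have out1 : ∀ w', H.Adj v w' → ∀ z1 z2, z1 ∉ insert v (NF H v) → z2 ∉ insert v (NF H v) →
      H.Adj w' z1 → H.Adj w' z2 → z1 = z2 := by
    intro w' hw' z1 z2 hz1 hz2 ha1 ha2
    by_contra hne
    obtain ⟨h1, h1'⟩ := hmem z1 hz1
    obtain ⟨h2, h2'⟩ := hmem z2 hz2
    have hst := hP.star hs1 ht1 {w', v} (cpair w' hw') ((NF H v).erase w' ∪ {z1, z2}) (by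
      intro a ha
      simp only [Finset.mem_union, Finset.mem_erase, mem_NF, Finset.mem_insert,
        Finset.mem_singleton] at ha
      simp only [Set.mem_insert_iff, Set.mem_singleton_iff, not_or]
      rcases ha with ⟨ha1, ha2⟩ | rfl | rfl
      · exact ⟨⟨ha1, ha2.ne'⟩, v, Or.inr rfl, ha2⟩
      · exact ⟨⟨ha1.ne', h1⟩, w', Or.inl rfl, ha1⟩
      · exact ⟨⟨ha2.ne', h2⟩, w', Or.inl rfl, ha2⟩)
    rw [Finset.card_union_of_disjoint, hcardE w' hw', Finset.card_pair hne] at hst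
    · omega
    · rw [Finset.disjoint_left]
      intro a ha hb
      simp only [Finset.mem_erase, mem_NF] at ha
      simp only [Finset.mem_insert, Finset.mem_singleton] at hb
      rcases hb with rfl | rfl
      · exact h1' ha.2
      · exact h2' ha.2
  have c3 : (H.induce {z, w, v}).Connected := conn_insert (cpair w hvw) (Or.inl rfl) hwz.symm
  have hout : (NF H z \ insert v (NF H v)).card ≤ 1 := by
    have hst := hP.star hs1 ht1 {z, w, v} c3 ((NF H v).erase w ∪ (NF H z \ insert v (NF H v))) (by
      intro a ha
      rw [Finset.mem_union, Finset.mem_erase, mem_NF, Finset.mem_sdiff, mem_NF] at ha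
      simp only [Set.mem_insert_iff, Set.mem_singleton_iff, not_or]
      rcases ha with ⟨ha1, ha2⟩ | ⟨ha1, ha2⟩
      · exact ⟨⟨fun h => hzn (h ▸ ha2), ha1, ha2.ne'⟩, v, by simp, ha2⟩
      · have := hmem a ha2
        exact ⟨⟨ha1.ne', fun h => this.2 (h ▸ hvw), this.1⟩, z, by simp, ha1⟩)
    rw [Finset.card_union_of_disjoint, hcardE w hvw] at hst
    · omega
    · rw [Finset.disjoint_left]
      intro a ha hb
      rw [Finset.mem_erase] at ha
      rw [Finset.mem_sdiff] at hb
      exact hb.2 (Finset.mem_insert_of_mem ha.2)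
  have hdz : (NF H z).card = t - 1 := h2 w z hvw hwz
  set Z := NF H z ∩ NF H v with hZ
  have hZc : Z.card < t - 1 := by
    refine hP.two hs ht2 {v} {z} (conn_single H v) (conn_single H z) ?_ Z ?_ ?_
    · rw [Set.disjoint_singleton]; exact hzv.symm
    · intro a ha
      simp only [hZ, Finset.mem_inter, mem_NF] at ha
      exact ⟨fun h => ha.2.ne' h, v, rfl, ha.2⟩
    · intro a ha
      simp only [hZ, Finset.mem_inter, mem_NF] at ha
      exact ⟨fun h => ha.1.ne' h, z, rfl, ha.1⟩
  have hsplit : NF H z = Z ∪ (NF H z \ insert v (NF H v)) := by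
    ext a
    simp only [hZ, Finset.mem_union, Finset.mem_inter, Finset.mem_sdiff, Finset.mem_insert, not_or]
    constructor
    · intro ha
      by_cases hav : a ∈ NF H v
      · exact Or.inl ⟨ha, hav⟩
      · refine Or.inr ⟨ha, ?_, hav⟩
        rintro rfl
        exact hzn (mem_NF.1 ha).symm
    · rintro (h | h)
      · exact h.1
      · exact h.1
  have hle := Finset.card_union_le Z (NF H z \ insert v (NF H v))
  rw [← hsplit, hdz] at hle
  obtain ⟨y, hy⟩ := Finset.card_eq_one.1 (show (NF H z \ insert v (NF H v)).card = 1 by omega)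
  have hy' : y ∈ NF H z \ insert v (NF H v) := by rw [hy]; simp
  rw [Finset.mem_sdiff, mem_NF] at hy'
  obtain ⟨hzy, hyS⟩ := hy'
  obtain ⟨hyv, hyn⟩ := hmem y hyS
  have hdy : (NF H y).card = t - 1 := h3 w z y hvw hwz hzy
  have hyZ : ∀ a ∈ Z, ¬ H.Adj y a := by
    intro a ha hya
    simp only [hZ, Finset.mem_inter, mem_NF] at ha
    exact hzy.ne (out1 a ha.2 z y hzS hyS ha.1.symm hya.symm)
  have hsub : Z ⊆ NF H v := Finset.inter_subset_right
  have hdv : (NF H v).card = t - 1 := hv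
  obtain ⟨u, hu⟩ := Finset.card_eq_one.1 (show (NF H v \ Z).card = 1 by
    rw [Finset.card_sdiff_of_subset hsub]; omega)
  have hyu : ¬ H.Adj y u := by
    intro hyu
    have := hP.two hs ht2 {v} {y, z} (conn_single H v) (conn_insert (conn_single H z) rfl hzy.symm)
      (by simp [Set.disjoint_singleton_left, hyv.symm, hzv.symm]) (NF H v)
      (by
        intro a ha
        rw [mem_NF] at ha
        exact ⟨fun h => ha.ne' h, v, rfl, ha⟩)
      (by
        intro a ha
        have ha' := mem_NF.1 ha
        refine ⟨?_, ?_⟩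
        · simp only [Set.mem_insert_iff, Set.mem_singleton_iff, not_or]
          exact ⟨fun h => hyn (h ▸ ha'), fun h => hzn (h ▸ ha')⟩
        · by_cases haZ : a ∈ Z
          · simp only [hZ, Finset.mem_inter, mem_NF] at haZ
            exact ⟨z, by simp, haZ.1⟩
          · have : a ∈ NF H v \ Z := Finset.mem_sdiff.2 ⟨ha, haZ⟩
            rw [hu, Finset.mem_singleton] at this
            exact ⟨y, by simp, this ▸ hyu⟩)
    omega
  have hyS' : ∀ a ∈ insert v (NF H v), ¬ H.Adj y a := by
    intro a ha hya
    rcases Finset.mem_insert.1 ha with rfl | ha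
    · exact hyn hya.symm
    · by_cases haZ : a ∈ Z
      · exact hyZ a haZ hya
      · have : a ∈ NF H v \ Z := Finset.mem_sdiff.2 ⟨ha, haZ⟩
        rw [hu, Finset.mem_singleton] at this
        exact hyu (this ▸ hya)
  have c4 : (H.induce {y, z, w, v}).Connected := conn_insert c3 (Or.inl rfl) hzy.symm
  have hst := hP.star hs1 ht1 {y, z, w, v} c4 ((NF H v).erase w ∪ (NF H y).erase z) (by
      intro a ha
      simp only [Finset.mem_union, Finset.mem_erase, mem_NF] at ha
      simp only [Set.mem_insert_iff, Set.mem_singleton_iff, not_or]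
      rcases ha with ⟨ha1, ha2⟩ | ⟨ha1, ha2⟩
      · exact ⟨⟨fun h => hyn (h ▸ ha2), fun h => hzn (h ▸ ha2), ha1, ha2.ne'⟩, v, by simp, ha2⟩
      · refine ⟨⟨ha2.ne', ha1, ?_, ?_⟩, y, by simp, ha2⟩
        · rintro rfl
          exact hyS' a hw ha2
        · rintro rfl
          exact hyS' a (Finset.mem_insert_self _ _) ha2)
  rw [Finset.card_union_of_disjoint, hcardE w hvw,
    Finset.card_erase_of_mem (mem_NF.2 hzy.symm)] at hst
  · omega
  · rw [Finset.disjoint_left]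
    intro a ha hb
    rw [Finset.mem_erase] at ha hb
    exact hyS' a (Finset.mem_insert_of_mem ha.2) (mem_NF.1 hb.2)

/-- closed neighbourhood of a set -/
noncomputable def nbh {V : Type} [Fintype V] (H : SimpleGraph V) (L : Finset V) : Finset V :=
  L.biUnion (fun v => insert v (NF H v))

theorem nbh_card {V : Type} [Fintype V] (H : SimpleGraph V) (L : Finset V) (t : ℕ)
    (h : ∀ v, dg H v < t) : (nbh H L).card ≤ L.card * t := by
  apply Finset.card_biUnion_le_card_mul
  intro v _
  have := Finset.card_insert_le v (NF H v)
  have h2 := h v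
  unfold dg at h2
  omega

theorem mem_nbh {V : Type} [Fintype V] {H : SimpleGraph V} {L : Finset V} {u v : V}
    (hv : v ∈ L) (h : H.Adj u v) : u ∈ nbh H L :=
  Finset.mem_biUnion.2 ⟨v, hv, Finset.mem_insert_of_mem (mem_NF.2 h.symm)⟩

theorem subset_nbh {V : Type} [Fintype V] {H : SimpleGraph V} {L : Finset V} {v : V}
    (hv : v ∈ L) : v ∈ nbh H L :=
  Finset.mem_biUnion.2 ⟨v, hv, Finset.mem_insert_self _ _⟩

theorem low_card {s t : ℕ} {V : Type} [Fintype V] {H : SimpleGraph V} {ρ k : ℝ} {x : V → ℝ}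
    (E : ExtG s t H ρ k x) (hρt : (t : ℝ) ≤ ρ) :
    (Finset.univ.filter (fun v => dg H v ≠ t - 1)).card ≤ t * t := by
  have h := def_bound E hρt
  have ht := E.ht
  have hlt : ∀ v, dg H v < t := E.hP.dg_lt (by have := E.hs; omega) (by omega)
  have h1 : ∑ v ∈ Finset.univ.filter (fun v => dg H v ≠ t - 1), (1 : ℝ) ≤
      ∑ v, ((t : ℝ) - 1 - dg H v) := by
    rw [Finset.sum_filter]
    apply Finset.sum_le_sum
    intro v _
    have := hlt v
    split_ifs with hd
    · have : dg H v + 2 ≤ t := by omega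
      have : ((dg H v + 2 : ℕ) : ℝ) ≤ t := by exact_mod_cast this
      push_cast at this
      linarith
    · have : dg H v + 1 ≤ t := by omega
      have : ((dg H v + 1 : ℕ) : ℝ) ≤ t := by exact_mod_cast this
      push_cast at this
      linarith
  rw [Finset.sum_const, nsmul_eq_mul, mul_one] at h1
  have h2 : ((Finset.univ.filter (fun v => dg H v ≠ t - 1)).card : ℝ) ≤ ((t * t : ℕ) : ℝ) := by
    push_cast
    have : (0 : ℝ) ≤ t := Nat.cast_nonneg _
    nlinarith
  exact_mod_cast h2

theorem grow {s t : ℕ} {V : Type} [Fintype V] {H : SimpleGraph V} {ρ k : ℝ} {x : V → ℝ}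
    (E : ExtG s t H ρ k x) (hρt : (t : ℝ) ≤ ρ) (U : Finset V)
    (hU : ∀ u ∈ U, ∀ v, H.Adj u v → v ∈ U) (m : ℕ)
    (hN : U.card + m * t + t ^ 5 < Fintype.card V) :
    ∃ A : Finset V, (∀ u ∈ A, ∀ v, H.Adj u v → v ∈ A) ∧ Disjoint U A ∧ A.card = m * t := by
  have ht := E.ht
  have hlt : ∀ v, dg H v < t := E.hP.dg_lt (by have := E.hs; omega) (by omega)
  induction m with
  | zero => exact ⟨∅, by simp, by simp, by simp⟩
  | succ m ih =>
    obtain ⟨A, hA, hd, hc⟩ := ih (by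
      have : m * t ≤ (m + 1) * t := Nat.mul_le_mul_right _ (by omega)
      omega)
    set L := Finset.univ.filter (fun v => dg H v ≠ t - 1) with hL
    have hLc : L.card ≤ t * t := low_card E hρt
    set B := nbh H (nbh H (nbh H L)) with hB
    have hBc : B.card ≤ t ^ 5 := by
      have h1 := nbh_card H L t hlt
      have h2 := nbh_card H (nbh H L) t hlt
      have h3 := nbh_card H (nbh H (nbh H L)) t hlt
      calc B.card ≤ (nbh H (nbh H L)).card * t := h3
        _ ≤ (nbh H L).card * t * t := Nat.mul_le_mul_right _ h2
        _ ≤ L.card * t * t * t := Nat.mul_le_mul_right _ (Nat.mul_le_mul_right _ h1)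
        _ ≤ t * t * t * t * t :=
          Nat.mul_le_mul_right _ (Nat.mul_le_mul_right _ (Nat.mul_le_mul_right _ hLc))
        _ = t ^ 5 := by ring
    obtain ⟨v, hv⟩ : ∃ v, v ∉ U ∪ A ∪ B := by
      by_contra hcon
      push Not at hcon
      have : U ∪ A ∪ B = Finset.univ := Finset.eq_univ_iff_forall.2 hcon
      have h1 := Finset.card_union_le (U ∪ A) B
      have h2 := Finset.card_union_le U A
      rw [this, Finset.card_univ] at h1
      have : m * t ≤ (m + 1) * t := Nat.mul_le_mul_right _ (by omega)
      omega
    simp only [Finset.mem_union, not_or] at hv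
    obtain ⟨⟨hvU, hvA⟩, hvB⟩ := hv
    have hLn : ∀ u, u ∉ L → dg H u = t - 1 := by
      intro u hu
      by_contra hne
      exact hu (by simp [hL, hne])
    have hvL : dg H v = t - 1 := hLn v (fun h => hvB (subset_nbh (subset_nbh (subset_nbh h))))
    have hclosed := loc E.hP E.hs E.ht v hvL
      (fun w z h1 h2 => hLn z (fun h => hvB (subset_nbh (mem_nbh (mem_nbh h h2) h1))))
      (fun w z y h1 h2 h3 => hLn y (fun h => hvB (mem_nbh (mem_nbh (mem_nbh h h3) h2) h1)))
    have hcS : (insert v (NF H v)).card = t := by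
      rw [Finset.card_insert_of_notMem (by rw [mem_NF]; exact fun h => h.ne rfl)]
      unfold dg at hvL
      omega
    have hdis : ∀ X : Finset V, (∀ u ∈ X, ∀ v, H.Adj u v → v ∈ X) → v ∉ X →
        Disjoint X (insert v (NF H v)) := by
      intro X hX hvX
      rw [Finset.disjoint_left]
      intro a ha hb
      rcases Finset.mem_insert.1 hb with rfl | hb
      · exact hvX ha
      · exact hvX (hX a ha v (mem_NF.1 hb).symm)
    refine ⟨A ∪ insert v (NF H v), ?_, ?_, ?_⟩
    · intro u hu w huw
      rcases Finset.mem_union.1 hu with h | h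
      · exact Finset.mem_union_left _ (hA u h w huw)
      · exact Finset.mem_union_right _ (hclosed u h w huw)
    · rw [Finset.disjoint_union_right]
      exact ⟨hd, hdis U hU hvU⟩
    · rw [Finset.card_union_of_disjoint (hdis A hA hvA), hc, hcS]
      ring

end PartLoc

section PartER
open Classical

theorem dg_eq_degree {V : Type} [Fintype V] (G : SimpleGraph V) (v : V) : dg G v = G.degree v := by
  unfold dg
  rw [← card_neighborFinset_eq_degree]
  congr 1
  ext u
  rw [mem_NF, mem_neighborFinset]

theorem reach_count {V : Type} [Fintype V] (G : SimpleGraph V) (S : Finset V)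
    (hS : ∀ u ∈ S, ∀ w ∈ S, G.Reachable u w) : 2 * S.card ≤ ∑ v, dg G v + 2 := by
  rcases S.eq_empty_or_nonempty with rfl | ⟨u, hu⟩
  · simp
  let c := G.connectedComponentMk u
  have hc := c.connected_toSimpleGraph.card_vert_le_card_edgeSet_add_one
  have he : Nat.card c.toSimpleGraph.edgeSet ≤ Nat.card G.edgeSet :=
    Finite.card_le_of_embedding (Embedding.induce (G := G) c.supp).mapEdgeSet
  have h1 : S.card ≤ Nat.card c := by
    have : Function.Injective (fun x : S => (⟨x.1, by
      have := hS x.1 x.2 u hu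
      exact ConnectedComponent.sound this⟩ : c)) := by
      intro x y h
      exact Subtype.ext (Subtype.mk.inj h)
    have := Nat.card_le_card_of_injective _ this
    simpa using this
  have h2 : ∑ v, dg G v = 2 * Nat.card G.edgeSet := by
    rw [Finset.sum_congr rfl (fun v _ => dg_eq_degree G v), sum_degrees_eq_twice_card_edges,
      Nat.card_eq_fintype_card, edgeFinset_card]
  omega

theorem card_inter_sum {V : Type} [Fintype V] (F : SimpleGraph V) (v : V) (X : Finset V) :
    (NF F v ∩ X).card = ∑ u ∈ X, if F.Adj v u then 1 else 0 := by
  rw [← Finset.sum_filter, Finset.sum_const, smul_eq_mul, mul_one]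
  congr 1
  ext u
  simp [mem_NF, and_comm]

theorem swap_inter {V : Type} [Fintype V] (F : SimpleGraph V) (P X : Finset V) :
    ∑ a ∈ P, (NF F a ∩ X).card = ∑ w ∈ X, (NF F w ∩ P).card := by
  simp only [card_inter_sum]
  rw [Finset.sum_comm]
  simp only [F.adj_comm]

/-- edges inside of X -/
def inside {V : Type} (F : SimpleGraph V) (X : Finset V) : SimpleGraph V where
  Adj u w := F.Adj u w ∧ u ∈ X ∧ w ∈ X
  symm := ⟨fun _ _ h => ⟨h.1.symm, h.2.2, h.2.1⟩⟩
  loopless := ⟨fun _ h => h.1.ne rfl⟩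

theorem sum_inside {V : Type} [Fintype V] (F : SimpleGraph V) (X : Finset V) :
    ∑ v, dg (inside F X) v = ∑ v ∈ X, (NF F v ∩ X).card := by
  rw [← Finset.sum_add_sum_compl X]
  have h1 : ∑ v ∈ Xᶜ, dg (inside F X) v = 0 := by
    apply Finset.sum_eq_zero
    intro v hv
    unfold dg
    rw [Finset.card_eq_zero, Finset.eq_empty_iff_forall_notMem]
    intro u hu
    rw [mem_NF] at hu
    exact (Finset.mem_compl.1 hv) hu.2.1
  rw [h1, add_zero]
  apply Finset.sum_congr rfl
  intro v hv
  unfold dg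
  congr 1
  ext u
  rw [Finset.mem_inter, mem_NF, mem_NF]
  exact ⟨fun h => ⟨h.1, h.2.2⟩, fun h => ⟨h.1, hv, h.2⟩⟩

theorem split_sum {V : Type} [Fintype V] (F : SimpleGraph V) (X : Finset V) :
    ∑ v, dg F v = ∑ y ∈ Xᶜ, dg F y + ∑ y ∈ Xᶜ, (NF F y ∩ X).card + ∑ v, dg (inside F X) v := by
  have h1 : ∀ v, dg F v = (NF F v ∩ X).card + (NF F v ∩ Xᶜ).card := by
    intro v
    unfold dg
    rw [← Finset.sdiff_eq_inter_compl, Finset.card_inter_add_card_sdiff]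
  rw [Finset.sum_congr rfl (fun v _ => h1 v), Finset.sum_add_distrib, swap_inter F Finset.univ Xᶜ,
    sum_inside, ← Finset.sum_add_sum_compl X (fun v => (NF F v ∩ X).card)]
  simp only [Finset.inter_univ]
  simp only [dg]
  omega

theorem ER {V : Type} [Fintype V] (F : SimpleGraph V) (n : ℕ) (hn : Fintype.card V = n)
    (hn6 : 6 ≤ n) (hlow : ∀ v, 2 ≤ dg F v) (hup : ∀ v, dg F v + 2 ≤ n)
    (hcom : ∀ u v, u ≠ v → ¬ F.Adj u v → ∃ w, F.Adj u w ∧ F.Adj v w) :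
    4 * n ≤ ∑ v, dg F v + 10 ∧ ((∃ v, dg F v + 2 = n) → 4 * n < ∑ v, dg F v + 10) := by
  have c1 : (∃ v, dg F v + 2 = n) → 4 * n < ∑ v, dg F v + 10 := by
    rintro ⟨v, hv⟩
    have hspl := split_sum F {v}ᶜ
    simp only [compl_compl, Finset.sum_singleton] at hspl
    have hcv : (NF F v ∩ {v}ᶜ).card = dg F v := by
      unfold dg
      congr 1
      ext u
      simp only [Finset.mem_inter, mem_NF, Finset.mem_compl, Finset.mem_singleton]
      exact ⟨fun h => h.1, fun h => ⟨h, h.ne'⟩⟩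
    obtain ⟨z, hz⟩ : ∃ z, z ∉ insert v (NF F v) := by
      by_contra hcon
      push Not at hcon
      have h1 : insert v (NF F v) = Finset.univ := Finset.eq_univ_iff_forall.2 hcon
      have h2 := Finset.card_insert_le v (NF F v)
      rw [h1, Finset.card_univ, hn] at h2
      unfold dg at hv
      omega
    simp only [Finset.mem_insert, mem_NF, not_or] at hz
    have hr : ∀ w, w ≠ v → (inside F {v}ᶜ).Reachable w z := by
      intro w hw
      by_cases hwz : w = z
      · rw [hwz]
      by_cases ha : F.Adj w z
      · exact Adj.reachable ⟨ha, by simpa using hw, by simpa using hz.1⟩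
      · obtain ⟨y, hy1, hy2⟩ := hcom w z hwz ha
        have hyv : y ≠ v := fun h => hz.2 (h ▸ hy2).symm
        exact (Adj.reachable (G := inside F {v}ᶜ) (u := w) (v := y)
          ⟨hy1, by simpa using hw, by simpa using hyv⟩).trans
          (Adj.reachable ⟨hy2.symm, by simpa using hyv, by simpa using hz.1⟩)
    have hrc := reach_count (inside F {v}ᶜ) {v}ᶜ (by
      intro a ha b hb
      exact (hr a (by simpa using ha)).trans (hr b (by simpa using hb)).symm)
    rw [Finset.card_compl, Finset.card_singleton, hn] at hrc
    omega
  refine ⟨?_, c1⟩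
  by_cases hex : ∃ v, dg F v + 2 = n
  · exact (c1 hex).le
  push Not at hex
  have hne : Nonempty V := Fintype.card_pos_iff.1 (by omega)
  obtain ⟨v, -, hmin⟩ := Finset.exists_min_image Finset.univ (dg F) ⟨hne.some, Finset.mem_univ _⟩
  have hmin : ∀ u, dg F v ≤ dg F u := fun u => hmin u (Finset.mem_univ u)
  have hsumge : ∀ X : Finset V, X.card * dg F v ≤ ∑ w ∈ X, dg F w := by
    intro X
    have := Finset.card_nsmul_le_sum X (dg F) (dg F v) (fun u _ => hmin u)
    simpa using this
  have hcomv : ∀ w, w ∉ insert v (NF F v) → ∃ a, F.Adj v a ∧ F.Adj w a := by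
    intro w hw
    simp only [Finset.mem_insert, mem_NF, not_or] at hw
    exact hcom v w (fun h => hw.1 h.symm) hw.2
  rcases (show dg F v = 2 ∨ dg F v = 3 ∨ 4 ≤ dg F v by have := hlow v; omega) with h2 | h3 | h4
  · -- minimum degree two
    obtain ⟨a, b, hab, hN⟩ := Finset.card_eq_two.1 h2
    have hNa : ∀ u, F.Adj v u ↔ u = a ∨ u = b := by
      intro u
      rw [← mem_NF, hN]
      simp
    have hva : F.Adj v a := (hNa a).2 (Or.inl rfl)
    have hvb : F.Adj v b := (hNa b).2 (Or.inr rfl)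
    set X : Finset V := ({v, a, b} : Finset V)ᶜ with hX
    have hXm : ∀ u, u ∈ X ↔ u ≠ v ∧ u ≠ a ∧ u ≠ b := by
      intro u; simp [hX]
    have hXc : X.card = n - 3 := by
      rw [hX, Finset.card_compl, hn, Finset.card_insert_of_notMem, Finset.card_pair hab]
      simp [hva.ne, hvb.ne]
    have hspl := split_sum F X
    rw [hX, compl_compl, ← hX] at hspl
    rw [Finset.sum_insert (by simp [hva.ne, hvb.ne]), Finset.sum_pair hab,
      Finset.sum_insert (by simp [hva.ne, hvb.ne]), Finset.sum_pair hab] at hspl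
    have hda : ∀ a', F.Adj v a' → (NF F a' ∩ X).card + 1 ≤ dg F a' := by
      intro a' ha'
      rw [← Finset.card_insert_of_notMem (a := v) (s := NF F a' ∩ X) (by simp [hXm])]
      apply Finset.card_le_card
      intro u hu
      rcases Finset.mem_insert.1 hu with rfl | hu
      · exact mem_NF.2 ha'.symm
      · exact (Finset.mem_inter.1 hu).1
    have ha1 := hda a hva
    have hb1 := hda b hvb
    -- classes
    set A := X.filter (fun w => ¬ F.Adj b w) with hA
    set B := X.filter (fun w => ¬ F.Adj a w) with hB
    have hor : ∀ w ∈ X, F.Adj a w ∨ F.Adj b w := by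
      intro w hw
      rw [hXm] at hw
      obtain ⟨c, hc1, hc2⟩ := hcomv w (by
        simp only [Finset.mem_insert, mem_NF, not_or, hNa]
        exact ⟨hw.1, hw.2.1, hw.2.2⟩)
      rcases (hNa c).1 hc1 with rfl | rfl
      · exact Or.inl hc2.symm
      · exact Or.inr hc2.symm
    have cA : A.card + (NF F b ∩ X).card = X.card := by
      have : NF F b ∩ X = X.filter (fun w => F.Adj b w) := by
        ext u; simp [mem_NF, and_comm]
      rw [this, add_comm]
      exact Finset.card_filter_add_card_filter_not _
    have cB : B.card + (NF F a ∩ X).card = X.card := by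
      have : NF F a ∩ X = X.filter (fun w => F.Adj a w) := by
        ext u; simp [mem_NF, and_comm]
      rw [this, add_comm]
      exact Finset.card_filter_add_card_filter_not _
    have hAne : A.Nonempty := by
      rw [← Finset.card_pos]
      have h1 := hup b
      have h2 := hex b
      omega
    have hBne : B.Nonempty := by
      rw [← Finset.card_pos]
      have h1 := hup a
      have h2 := hex a
      omega
    have hdisj : Disjoint A B := by
      rw [Finset.disjoint_left]
      intro w hw1 hw2
      simp only [hA, hB, Finset.mem_filter] at hw1 hw2
      rcases hor w hw1.1 with h | h
      · exact hw2.2 h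
      · exact hw1.2 h
    have hAB : ∀ p ∈ A, ∀ q ∈ B, (inside F X).Reachable p q := by
      intro p hp q hq
      have hpq : p ≠ q := fun h => Finset.disjoint_left.1 hdisj hp (h ▸ hq)
      simp only [hA, hB, Finset.mem_filter] at hp hq
      by_cases hadj : F.Adj p q
      · exact Adj.reachable ⟨hadj, hp.1, hq.1⟩
      obtain ⟨w, hw1, hw2⟩ := hcom p q hpq hadj
      have hwX : w ∈ X := by
        rw [hXm]
        refine ⟨?_, ?_, ?_⟩
        · rintro rfl
          have := (hXm p).1 hp.1
          rcases (hNa p).1 hw1.symm with h | h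
          · exact this.2.1 h
          · exact this.2.2 h
        · rintro rfl
          exact hq.2 hw2.symm
        · rintro rfl
          exact hp.2 hw1.symm
      exact (Adj.reachable (G := inside F X) (u := p) (v := w) ⟨hw1, hp.1, hwX⟩).trans
          (Adj.reachable ⟨hw2.symm, hwX, hq.1⟩)
    obtain ⟨p0, hp0⟩ := hAne
    obtain ⟨q0, hq0⟩ := hBne
    have hall : ∀ w ∈ A ∪ B, (inside F X).Reachable w p0 := by
      intro w hw
      rcases Finset.mem_union.1 hw with h | h
      · exact (hAB w h q0 hq0).trans (hAB p0 hp0 q0 hq0).symm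
      · exact (hAB p0 hp0 w h).symm
    have hrc := reach_count (inside F X) (A ∪ B)
      (fun u hu w hw => (hall u hu).trans (hall w hw).symm)
    rw [Finset.card_union_of_disjoint hdisj] at hrc
    omega
  · -- minimum degree three
    set X : Finset V := (insert v (NF F v))ᶜ with hX
    have hvN : v ∉ NF F v := by rw [mem_NF]; exact fun h => h.ne rfl
    have hXc : X.card = n - 4 := by
      rw [hX, Finset.card_compl, hn, Finset.card_insert_of_notMem hvN]
      unfold dg at h3
      omega
    have h1 : ∑ w, dg F w = dg F v + ∑ a ∈ NF F v, dg F a + ∑ w ∈ X, dg F w := by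
      rw [← Finset.sum_add_sum_compl (insert v (NF F v)), Finset.sum_insert hvN]
    have hda : ∀ a' ∈ NF F v, (NF F a' ∩ X).card + 1 ≤ dg F a' := by
      intro a' ha'
      rw [← Finset.card_insert_of_notMem (a := v) (s := NF F a' ∩ X) (by simp [hX])]
      apply Finset.card_le_card
      intro u hu
      rcases Finset.mem_insert.1 hu with rfl | hu
      · exact mem_NF.2 (mem_NF.1 ha').symm
      · exact (Finset.mem_inter.1 hu).1
    have h5 := Finset.sum_le_sum hda
    rw [Finset.sum_add_distrib, swap_inter, Finset.sum_const, smul_eq_mul, mul_one] at h5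
    have h6 : X.card * 1 ≤ ∑ w ∈ X, (NF F w ∩ NF F v).card := by
      have := Finset.card_nsmul_le_sum X (fun w => (NF F w ∩ NF F v).card) 1 (by
        intro w hw
        rw [hX, Finset.mem_compl] at hw
        obtain ⟨a, ha1, ha2⟩ := hcomv w hw
        exact Finset.card_pos.2 ⟨a, Finset.mem_inter.2 ⟨mem_NF.2 ha2, mem_NF.2 ha1⟩⟩)
      simpa using this
    have h7 := hsumge X
    rw [h3] at h7
    have h8 : (NF F v).card = 3 := h3
    omega
  · have := hsumge Finset.univ
    rw [Finset.card_univ, hn] at this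
    have h5 : n * 4 ≤ n * dg F v := Nat.mul_le_mul_left n h4
    omega

theorem ERQ {s t : ℕ} {V : Type} [Fintype V] {Q : SimpleGraph V} (hP : PP s t Q)
    (hs : 2 ≤ s) (ht : 4 ≤ t) (hn : Fintype.card V = t + 2) (hconn : Q.Connected) :
    ∑ v, dg Q v ≤ t * (t - 1) + 4 ∧ (∑ v, dg Q v = t * (t - 1) + 4 → ∀ v, 2 ≤ dg Q v) := by
  have hcomp : ∀ v, dg Q v + dg Qᶜ v = t + 1 := by
    intro v
    rw [dg_eq_degree, dg_eq_degree, degree_compl]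
    have := Q.degree_lt_card_verts v
    omega
  have hlt : ∀ v, dg Q v < t := hP.dg_lt (by omega) (by omega)
  have hpos : ∀ v, 0 < dg Q v := by
    intro v
    have : Nontrivial V := Fintype.one_lt_card_iff_nontrivial.1 (by omega)
    rw [dg_eq_degree]
    exact hconn.preconnected.degree_pos_of_nontrivial v
  obtain ⟨h1, h2⟩ := ER Qᶜ (t + 2) hn (by omega)
    (fun v => by have := hcomp v; have := hlt v; omega)
    (fun v => by have := hcomp v; have := hpos v; omega)
    (by
      intro u v huv hna
      have hadj : Q.Adj u v := by
        by_contra h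
        exact hna ((compl_adj _ _ _).2 ⟨huv, h⟩)
      by_contra hcon
      push Not at hcon
      have := hP.star (by omega) (by omega) {u, v}
        (conn_insert (conn_single Q v) rfl hadj) ({u, v} : Finset V)ᶜ (by
          intro x hx
          simp only [Finset.mem_compl, Finset.mem_insert, Finset.mem_singleton, not_or] at hx
          refine ⟨by simpa using hx, ?_⟩
          have hc := hcon x
          simp only [compl_adj, not_and, not_not] at hc
          by_cases hux : Q.Adj u x
          · exact ⟨u, by simp, hux⟩
          · exact ⟨v, by simp, hc ⟨fun h => hx.1 h.symm, hux⟩ (fun h => hx.2 h.symm)⟩)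
      rw [Finset.card_compl, hn, Finset.card_pair huv] at this
      omega)
  have hsum : ∑ v, dg Q v + ∑ v, dg Qᶜ v = (t + 2) * (t + 1) := by
    rw [← Finset.sum_add_distrib, Finset.sum_congr rfl (fun v _ => hcomp v), Finset.sum_const,
      Finset.card_univ, hn, smul_eq_mul]
  have hid : (t + 2) * (t + 1) + 10 = t * (t - 1) + 4 + 4 * (t + 2) := by
    obtain ⟨r, rfl⟩ : ∃ r, t = r + 1 := ⟨t - 1, by omega⟩
    simp only [Nat.add_sub_cancel]
    ring
  constructor
  · omega
  · intro heq v
    by_contra hv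
    have := h2 ⟨v, by have := hcomp v; have := hpos v; omega⟩
    omega

end PartER

section PartCases
open Classical

/-- disjoint union of a family of graphs -/
def sigG {ι : Type} {Y : ι → Type} (Q : ∀ i, SimpleGraph (Y i)) : SimpleGraph (Σ i, Y i) where
  Adj a b := ∃ i x y, a = ⟨i, x⟩ ∧ b = ⟨i, y⟩ ∧ (Q i).Adj x y
  symm := ⟨by rintro _ _ ⟨i, x, y, rfl, rfl, h⟩; exact ⟨i, y, x, rfl, rfl, h.symm⟩⟩
  loopless := ⟨by
    rintro _ ⟨i, x, y, rfl, h, h'⟩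
    exact h'.ne (sigma_mk_injective h)⟩

theorem PP_sigG {s t : ℕ} (ht : 1 ≤ t) {ι : Type} {Y : ι → Type} (Q : ∀ i, SimpleGraph (Y i))
    (h : ∀ i, PP s t (Q i)) : PP s t (sigG Q) := by
  refine PP.of_labels Sigma.fst ?_ ?_
  · rintro _ _ ⟨i, x, y, rfl, rfl, h⟩; rfl
  · intro i
    by_cases hne : Nonempty (Y i)
    · refine ⟨Y i, Q i, fun a => if h : a.1 = i then h ▸ a.2 else hne.some, h i, ?_, ?_⟩
      · rintro ⟨j, a⟩ ha ⟨l, b⟩ hb hab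
        have ha : j = i := ha
        have hb : l = i := hb
        subst ha
        subst hb
        simp only [dif_pos] at hab
        rw [hab]
      · rintro _ _ h1 _ ⟨j, x, y, rfl, rfl, h⟩
        have h1 : j = i := h1
        subst h1
        simpa using h
    · refine ⟨Unit, ⊤, fun _ => (), PP.of_card (by simpa using ht), ?_, ?_⟩
      · rintro ⟨j, a⟩ ha
        have ha : j = i := ha
        subst ha
        exact absurd ⟨a⟩ hne
      · rintro ⟨j, a⟩ _ ha
        have ha : j = i := ha
        subst ha
        exact absurd ⟨a⟩ hne

theorem dg_sigG {ι : Type} [Fintype ι] {Y : ι → Type} [∀ i, Fintype (Y i)]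
    (Q : ∀ i, SimpleGraph (Y i)) (i : ι) (x : Y i) : dg (sigG Q) ⟨i, x⟩ = dg (Q i) x := by
  unfold dg
  rw [← Finset.card_image_of_injective (NF (Q i) x) (sigma_mk_injective (i := i))]
  congr 1
  ext a
  simp only [mem_NF, Finset.mem_image]
  constructor
  · rintro ⟨j, x', y, h1, rfl, h⟩
    have : i = j := congrArg Sigma.fst h1
    subst this
    have := sigma_mk_injective h1
    subst this
    exact ⟨y, h, rfl⟩
  · rintro ⟨y, h, rfl⟩
    exact ⟨i, x, y, rfl, rfl, h⟩

theorem dg_top (m : ℕ) (x : Fin m) : dg (⊤ : SimpleGraph (Fin m)) x = m - 1 := by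
  have : NF (⊤ : SimpleGraph (Fin m)) x = Finset.univ.erase x := by
    ext u
    rw [mem_NF, top_adj, Finset.mem_erase]
    simp [eq_comm]
  rw [dg, this, Finset.card_erase_of_mem (Finset.mem_univ _), Finset.card_univ, Fintype.card_fin]

theorem dg_sub {V : Type} [Fintype V] (H : SimpleGraph V) (A : Finset V)
    (hA : ∀ u ∈ A, ∀ v, H.Adj u v → v ∈ A) (x : {v // v ∈ A}) :
    dg (H.comap (Subtype.val : {v // v ∈ A} → V)) x = dg H x.1 := by
  unfold dg
  rw [← Finset.card_image_of_injective (NF (H.comap (Subtype.val : {v // v ∈ A} → V)) x)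
    Subtype.val_injective]
  congr 1
  ext a
  simp only [mem_NF, Finset.mem_image, comap_adj]
  constructor
  · rintro ⟨y, h, rfl⟩
    exact h
  · intro h
    exact ⟨⟨a, hA x.1 x.2 a h⟩, h, rfl⟩

theorem PP_sub {s t : ℕ} {V : Type} {H : SimpleGraph V} (hP : PP s t H) (A : Finset V) :
    PP s t (H.comap (Subtype.val : {v // v ∈ A} → V)) :=
  hP.of_inj Subtype.val Subtype.val_injective (fun _ _ h => h)

theorem sum_dg_sub {V : Type} [Fintype V] (H : SimpleGraph V) (A : Finset V)
    (hA : ∀ u ∈ A, ∀ v, H.Adj u v → v ∈ A) :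
    ∑ x, dg (H.comap (Subtype.val : {v // v ∈ A} → V)) x = ∑ v ∈ A, dg H v := by
  rw [Finset.sum_congr rfl (fun x _ => dg_sub H A hA x), ← Finset.sum_coe_sort A]

theorem dg_le_closed {V : Type} [Fintype V] (H : SimpleGraph V) (A : Finset V)
    (hA : ∀ u ∈ A, ∀ v, H.Adj u v → v ∈ A) (v : V) (hv : v ∈ A) : dg H v + 1 ≤ A.card := by
  unfold dg
  rw [← Finset.card_insert_of_notMem (a := v) (s := NF H v) (by rw [mem_NF]; exact fun h => h.ne rfl)]
  apply Finset.card_le_card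
  intro u hu
  rcases Finset.mem_insert.1 hu with rfl | h
  · exact hv
  · exact hA v hv u (mem_NF.1 h)

theorem closed_union {V : Type} {H : SimpleGraph V} {A B : Finset V}
    (hA : ∀ u ∈ A, ∀ v, H.Adj u v → v ∈ A) (hB : ∀ u ∈ B, ∀ v, H.Adj u v → v ∈ B) :
    ∀ u ∈ A ∪ B, ∀ v, H.Adj u v → v ∈ A ∪ B := by
  intro u hu v huv
  rcases Finset.mem_union.1 hu with h | h
  · exact Finset.mem_union_left _ (hA u h v huv)
  · exact Finset.mem_union_right _ (hB u h v huv)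

theorem lexM {s t : ℕ} {V : Type} [Fintype V] {H : SimpleGraph V} {ρ k : ℝ} {x : V → ℝ}
    (E : ExtG s t H ρ k x) (hρ : 4 * (t : ℝ) ^ 5 + 2 * t ≤ ρ)
    (A : Finset V) (hA : ∀ u ∈ A, ∀ v, H.Adj u v → v ∈ A) (hAc : A.card ≤ t ^ 2)
    {W : Type} [Fintype W] (B : SimpleGraph W) (hB : PP s t B) (hc : Fintype.card W = A.card) :
    (∑ w, dg B w ≤ ∑ v ∈ A, dg H v) ∧ (∑ w, dg B w = ∑ v ∈ A, dg H v →
      ∑ w, dg B w ^ 2 ≤ ∑ v ∈ A, dg H v ^ 2) := by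
  apply lex E A hA B hB hc
  have h1 : (A.card : ℝ) ≤ t ^ 2 := by exact_mod_cast hAc
  have h2 : (A.card : ℝ) * t ^ 3 ≤ t ^ 2 * t ^ 3 := mul_le_mul_of_nonneg_right h1 (by positivity)
  nlinarith

theorem caseA {s t : ℕ} {V : Type} [Fintype V] {H : SimpleGraph V} {ρ k : ℝ} {x : V → ℝ}
    (E : ExtG s t H ρ k x) (hρ : 4 * (t : ℝ) ^ 5 + 2 * t ≤ ρ)
    (hN : t ^ 5 + t ^ 2 < Fintype.card V) (C c : Finset V)
    (hC : ∀ u ∈ C, ∀ v, H.Adj u v → v ∈ C) (hc : ∀ u ∈ c, ∀ v, H.Adj u v → v ∈ c)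
    (hCc : C.card = t + 1) (hne : c.Nonempty) (hlt : c.card < t) (hd : Disjoint C c) : False := by
  have ht := E.ht
  have hs := E.hs
  have hP := E.hP
  have hdl : ∀ v, dg H v ≤ t - 1 := fun v => by
    have := hP.dg_lt (by omega) (by omega) v
    omega
  have hρt : (t : ℝ) ≤ ρ := by
    have : (0 : ℝ) ≤ (t : ℝ) ^ 5 := by positivity
    have : (0 : ℝ) ≤ t := Nat.cast_nonneg _
    linarith
  set m := c.card with hm
  have hm1 : 1 ≤ m := Finset.card_pos.2 hne
  have hDc : ∑ v ∈ c, dg H v ≤ m * (m - 1) := by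
    have := Finset.sum_le_card_nsmul c (dg H) (m - 1) (fun v hv => by
      have := dg_le_closed H c hc v hv
      omega)
    simpa using this
  have l1 := (lexM E hρ (C ∪ c) (closed_union hC hc) (by
      rw [Finset.card_union_of_disjoint hd, hCc]
      nlinarith) (sigG (fun i : Fin 2 => (⊤ : SimpleGraph (Fin (![t, m + 1] i)))))
    (PP_sigG (by omega) _ (fun i => PP.of_card (by
      rw [Fintype.card_fin]
      fin_cases i
      · simp
      · simp
        omega))) (by
      rw [Finset.card_union_of_disjoint hd, hCc, Fintype.card_sigma]
      simp only [Fin.sum_univ_two, Fintype.card_fin]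
      simp
      omega)).1
  rw [Finset.sum_union hd, Fintype.sum_sigma] at l1
  simp only [dg_sigG, dg_top, Finset.sum_const, Finset.card_univ, Fintype.card_fin, smul_eq_mul,
    Fin.sum_univ_two] at l1
  simp only [Matrix.cons_val_zero, Matrix.cons_val_one, Nat.add_sub_cancel] at l1
  have hmt : m * t ≤ t ^ 2 := by nlinarith
  have hmt1 : m * (t + 1) ≤ t ^ 2 := by
    have : m ≤ t - 1 := by omega
    have h2 : m * (t + 1) ≤ (t - 1) * (t + 1) := Nat.mul_le_mul_right _ this
    obtain ⟨r, rfl⟩ : ∃ r, t = r + 1 := ⟨t - 1, by omega⟩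
    simp only [Nat.add_sub_cancel] at h2
    nlinarith
  obtain ⟨A, hA, hdA, hAc⟩ := grow E hρt c hc m (by nlinarith)
  have l2 := (lexM E hρ (c ∪ A) (closed_union hc hA) (by
      rw [Finset.card_union_of_disjoint hdA, hAc]
      nlinarith) (sigG (fun _ : Fin m => H.comap (Subtype.val : {v // v ∈ C} → V)))
    (PP_sigG (by omega) _ (fun i => PP_sub hP C)) (by
      rw [Finset.card_union_of_disjoint hdA, hAc, Fintype.card_sigma]
      simp only [Finset.sum_const, Finset.card_univ, Fintype.card_fin, smul_eq_mul,
        Fintype.card_coe, hCc]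
      ring)).1
  rw [Finset.sum_union hdA, Fintype.sum_sigma] at l2
  simp only [dg_sigG, sum_dg_sub H C hC] at l2
  rw [Finset.sum_const, Finset.card_univ, Fintype.card_fin, smul_eq_mul] at l2
  have hDA : ∑ v ∈ A, dg H v ≤ m * t * (t - 1) := by
    have := Finset.sum_le_card_nsmul A (dg H) (t - 1) (fun v _ => hdl v)
    rwa [smul_eq_mul, hAc] at this
  obtain ⟨r, hr⟩ : ∃ r, t = r + 1 := ⟨t - 1, by omega⟩
  obtain ⟨q, hq⟩ : ∃ q, m = q + 1 := ⟨m - 1, by omega⟩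
  rw [hr] at l1 hDA
  rw [hq] at l1 l2 hDA hDc
  simp only [Nat.add_sub_cancel] at l1 l2 hDA hDc
  set D := ∑ v ∈ C, dg H v
  nlinarith

theorem caseB {s t : ℕ} {V : Type} [Fintype V] {H : SimpleGraph V} {ρ k : ℝ} {x : V → ℝ}
    (E : ExtG s t H ρ k x) (hρ : 4 * (t : ℝ) ^ 5 + 2 * t ≤ ρ)
    (hN : t ^ 5 + t ^ 2 < Fintype.card V) (C c : Finset V)
    (hC : ∀ u ∈ C, ∀ v, H.Adj u v → v ∈ C) (hc : ∀ u ∈ c, ∀ v, H.Adj u v → v ∈ c)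
    (hCc : C.card = t + 1) (hcc : c.card = t + 2) (hd : Disjoint C c)
    (hconn : (H.comap (Subtype.val : {v // v ∈ c} → V)).Connected) : False := by
  have ht := E.ht
  have hs := E.hs
  have hP := E.hP
  have hdl : ∀ v, dg H v ≤ t - 1 := fun v => by
    have := hP.dg_lt (by omega) (by omega) v
    omega
  have hρt : (t : ℝ) ≤ ρ := by
    have : (0 : ℝ) ≤ (t : ℝ) ^ 5 := by positivity
    have : (0 : ℝ) ≤ t := Nat.cast_nonneg _
    linarith
  have l1 := lexM E hρ (C ∪ c) (closed_union hC hc) (by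
      rw [Finset.card_union_of_disjoint hd, hCc, hcc]
      nlinarith) (sigG (fun i : Fin 3 => (⊤ : SimpleGraph (Fin (![t, t, 3] i)))))
    (PP_sigG (by omega) _ (fun i => PP.of_card (by
      rw [Fintype.card_fin]
      fin_cases i
      · simp
      · simp
      · simp
        omega))) (by
      rw [Finset.card_union_of_disjoint hd, hCc, hcc, Fintype.card_sigma]
      simp only [Fin.sum_univ_three, Fintype.card_fin]
      simp
      omega)
  rw [Finset.sum_union hd, Fintype.sum_sigma, Finset.sum_union hd, Fintype.sum_sigma] at l1
  simp only [dg_sigG, dg_top, Finset.sum_const, Finset.card_univ, Fintype.card_fin, smul_eq_mul,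
    Fin.sum_univ_three] at l1
  simp only [Matrix.cons_val_zero, Matrix.cons_val_one, Matrix.cons_val_two, Matrix.tail_cons,
    Matrix.head_cons] at l1
  obtain ⟨l1, l1'⟩ := l1
  obtain ⟨A, hA, hdA, hAc⟩ := grow E hρt c hc 1 (by nlinarith)
  have l2 := (lexM E hρ (c ∪ A) (closed_union hc hA) (by
      rw [Finset.card_union_of_disjoint hdA, hAc]
      nlinarith) (sigG (fun _ : Fin 2 => H.comap (Subtype.val : {v // v ∈ C} → V)))
    (PP_sigG (by omega) _ (fun i => PP_sub hP C)) (by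
      rw [Finset.card_union_of_disjoint hdA, hAc, Fintype.card_sigma]
      simp only [Finset.sum_const, Finset.card_univ, Fintype.card_fin, smul_eq_mul,
        Fintype.card_coe, hCc]
      omega)).1
  rw [Finset.sum_union hdA, Fintype.sum_sigma] at l2
  simp only [dg_sigG, sum_dg_sub H C hC] at l2
  rw [Finset.sum_const, Finset.card_univ, Fintype.card_fin, smul_eq_mul] at l2
  have hDA : ∑ v ∈ A, dg H v ≤ t * (t - 1) := by
    have := Finset.sum_le_card_nsmul A (dg H) (t - 1) (fun v _ => hdl v)
    rwa [smul_eq_mul, hAc, one_mul] at this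
  obtain ⟨e1, e2⟩ := ERQ (PP_sub hP c) hs ht (by simpa using hcc) hconn
  rw [sum_dg_sub H c hc] at e1 e2
  have hDc : ∑ v ∈ c, dg H v = t * (t - 1) + 4 := by omega
  have hD1 : ∑ v ∈ C, dg H v = t * (t - 1) + 2 := by omega
  have l3 := l1' (by omega)
  have hc2 : ∀ v ∈ c, 2 ≤ dg H v := by
    intro v hv
    have := e2 hDc ⟨v, hv⟩
    rwa [dg_sub H c hc] at this
  obtain ⟨r, hr⟩ : ∃ r, t = r + 1 := ⟨t - 1, by omega⟩
  have hr3 : 3 ≤ r := by omega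
  have htr : t - 1 = r := by omega
  rw [htr] at hdl hD1 hDc l3
  have hdef : ∑ v ∈ C, (r - dg H v) + 2 = r := by
    have h1 : ∑ v ∈ C, (r - dg H v) + ∑ v ∈ C, dg H v = (t + 1) * r := by
      rw [← Finset.sum_add_distrib, Finset.sum_congr rfl (fun v _ => Nat.sub_add_cancel (hdl v)),
        Finset.sum_const, hCc, smul_eq_mul]
    rw [hD1] at h1
    have : (t + 1) * r = t * r + r := by ring
    omega
  have hC2 : ∀ v ∈ C, 2 ≤ dg H v := by
    intro v hv
    have := Finset.single_le_sum (f := fun v => r - dg H v) (fun _ _ => Nat.zero_le _) hv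
    have := hdl v
    omega
  -- quadratic estimates
  have key : ∀ d, 2 ≤ d → d ≤ r → d ^ 2 + 2 * r + (d - 2) * (r - d) = (r + 2) * d := by
    intro d h1 h2
    obtain ⟨a, rfl⟩ : ∃ a, d = 2 + a := ⟨d - 2, by omega⟩
    obtain ⟨b, rfl⟩ : ∃ b, r = 2 + a + b := ⟨r - (2 + a), by omega⟩
    rw [Nat.add_sub_cancel_left, Nat.add_sub_cancel_left]
    ring
  have qc : ∑ v ∈ c, dg H v ^ 2 + (t + 2) * (2 * r) ≤ (r + 2) * (t * r + 4) := by
    rw [← hDc, Finset.mul_sum, ← hcc, ← smul_eq_mul, ← Finset.sum_const, ← Finset.sum_add_distrib]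
    apply Finset.sum_le_sum
    intro v hv
    have := key _ (hc2 v hv) (hdl v)
    omega
  have qC : ∑ v ∈ C, dg H v ^ 2 + (t + 1) * (2 * r) + ∑ v ∈ C, (dg H v - 2) * (r - dg H v) =
      (r + 2) * (t * r + 2) := by
    rw [← hD1, Finset.mul_sum, ← hCc, ← smul_eq_mul, ← Finset.sum_const, ← Finset.sum_add_distrib,
      ← Finset.sum_add_distrib]
    apply Finset.sum_congr rfl
    intro v hv
    exact key _ (hC2 v hv) (hdl v)
  have hz : ∑ v ∈ C, (dg H v - 2) * (r - dg H v) = 0 := by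
    have : ∑ v ∈ C, (dg H v - 2) * (r - dg H v) ≤ 0 := by
      rw [hr] at l3 qc qC
      nlinarith
    omega
  have hdich : ∀ v ∈ C, dg H v = 2 ∨ dg H v = r := by
    intro v hv
    have := (Finset.sum_eq_zero_iff.1 hz) v hv
    have h1 := hC2 v hv
    have h2 := hdl v
    rcases Nat.mul_eq_zero.1 this with h | h <;> omega
  obtain ⟨p, hp, hpr⟩ : ∃ p ∈ C, r - dg H p ≠ 0 := by
    apply Finset.exists_ne_zero_of_sum_ne_zero
    omega
  have hp2 : dg H p = 2 := by
    rcases hdich p hp with h | h <;> omega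
  have hoth : ∀ v ∈ C, v ≠ p → dg H v = r := by
    intro v hv hvp
    have h1 := Finset.add_sum_erase C (fun v => r - dg H v) hp
    have h2 := Finset.single_le_sum (s := C.erase p) (f := fun v => r - dg H v)
      (fun _ _ => Nat.zero_le _) (Finset.mem_erase.2 ⟨hvp, hv⟩)
    have := hdl v
    omega
  obtain ⟨a, ha⟩ : (NF H p).Nonempty := by
    rw [← Finset.card_pos]
    unfold dg at hp2
    omega
  rw [mem_NF] at ha
  have haC : a ∈ C := hC p hp a ha
  have hda : (NF H a).card = r := hoth a haC ha.ne'
  have haN : a ∉ NF H a := by rw [mem_NF]; exact fun h => h.ne rfl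
  have hsub : ∀ a ∈ C, NF H a ⊆ C := fun a haC u hu => hC a haC u (mem_NF.1 hu)
  obtain ⟨b, hbC, hb⟩ : ∃ b ∈ C, b ∉ insert a (NF H a) := by
    by_contra hcon
    push Not at hcon
    have h1 := Finset.card_le_card (show C ⊆ insert a (NF H a) from hcon)
    rw [Finset.card_insert_of_notMem haN] at h1
    omega
  simp only [Finset.mem_insert, mem_NF, not_or] at hb
  have hbp : b ≠ p := fun h => hb.2 (h ▸ ha.symm)
  have hdb : (NF H b).card = r := hoth b hbC hbp
  have hTc : ((C.erase a).erase b).card = r := by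
    rw [Finset.card_erase_of_mem (Finset.mem_erase.2 ⟨hb.1, hbC⟩), Finset.card_erase_of_mem haC]
    omega
  have hNa : NF H a = (C.erase a).erase b := by
    apply Finset.eq_of_subset_of_card_le
    · intro u hu
      refine Finset.mem_erase.2 ⟨?_, Finset.mem_erase.2 ⟨?_, hsub a haC hu⟩⟩
      · rintro rfl; exact hb.2 (mem_NF.1 hu)
      · rintro rfl; exact haN hu
    · omega
  have hNb : NF H b = (C.erase a).erase b := by
    apply Finset.eq_of_subset_of_card_le
    · intro u hu
      refine Finset.mem_erase.2 ⟨?_, Finset.mem_erase.2 ⟨?_, hsub b hbC hu⟩⟩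
      · rintro rfl; exact (mem_NF.1 hu).ne rfl
      · rintro rfl; exact hb.2 (mem_NF.1 hu).symm
    · omega
  have := hP.two hs (by omega) {a} {b} (conn_single H a) (conn_single H b)
    (by rw [Set.disjoint_singleton]; exact fun h => hb.1 h.symm) ((C.erase a).erase b)
    (by
      intro u hu
      rw [← hNa, mem_NF] at hu
      exact ⟨fun h => hu.ne' h, a, rfl, hu⟩)
    (by
      intro u hu
      rw [← hNb, mem_NF] at hu
      exact ⟨fun h => hu.ne' h, b, rfl, hu⟩)
  omega

end PartCases

section PartMain
open Classical

theorem supp_closed {V : Type} (H : SimpleGraph V) (c : H.ConnectedComponent) :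
    ∀ u ∈ c.supp, ∀ v, H.Adj u v → v ∈ c.supp := by
  intro u hu v huv
  exact (ConnectedComponent.mem_supp_congr_adj c huv).1 hu

theorem final_abs {s t : ℕ} {V : Type} [Fintype V] {H : SimpleGraph V} {ρ k : ℝ} {x : V → ℝ}
    (E : ExtG s t H ρ k x) (hρ : 4 * (t : ℝ) ^ 5 + 2 * t ≤ ρ)
    (hN : t ^ 5 + t ^ 2 < Fintype.card V) (C c : H.ConnectedComponent)
    (hC : C.supp.ncard = t + 1) : t ≤ c.supp.ncard ∧ c.supp.ncard ≠ t + 2 := by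
  have hn : ∀ d : H.ConnectedComponent, d.supp.toFinset.card = d.supp.ncard := fun d =>
    (Set.ncard_eq_toFinset_card' _).symm
  have hcl : ∀ d : H.ConnectedComponent, ∀ u ∈ d.supp.toFinset, ∀ v, H.Adj u v →
      v ∈ d.supp.toFinset := by
    intro d u hu v huv
    rw [Set.mem_toFinset] at hu ⊢
    exact supp_closed H d u hu v huv
  have hdis : C ≠ c → Disjoint C.supp.toFinset c.supp.toFinset := by
    intro hne
    rw [Finset.disjoint_left]
    intro u h1 h2
    rw [Set.mem_toFinset, ConnectedComponent.mem_supp_iff] at h1 h2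
    exact hne (h1.symm.trans h2)
  constructor
  · by_contra hlt
    push Not at hlt
    have hne : C ≠ c := by
      rintro rfl
      omega
    refine caseA E hρ hN C.supp.toFinset c.supp.toFinset (hcl C) (hcl c) (by rw [hn, hC]) ?_
      (by rw [hn]; exact hlt) (hdis hne)
    rw [Set.toFinset_nonempty]
    exact c.nonempty_supp
  · intro heq
    have hne : C ≠ c := by
      rintro rfl
      omega
    refine caseB E hρ hN C.supp.toFinset c.supp.toFinset (hcl C) (hcl c) (by rw [hn, hC])
      (by rw [hn, heq]) (hdis hne) ?_
    have h1 : (H.induce c.supp).Connected := c.connected_toSimpleGraph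
    have h2 : c.supp = {v | v ∈ c.supp.toFinset} := by
      ext v
      rw [Set.mem_ofPred_eq, Set.mem_toFinset]
    rw [h2] at h1
    exact h1

theorem main_thm (s t : ℕ) (ht : 4 ≤ t) (hs : 2 ≤ s) (hst : s ≤ t) :
    ∃ n₀ : ℕ, ∀ n : ℕ, n₀ ≤ n →
    ∀ (G : SimpleGraph (Fin n)) (K : Finset (Fin n)),
      ¬ MinorOf (completeBipartiteGraph (Fin s) (Fin t)) G →
      (∀ G' : SimpleGraph (Fin n),
        ¬ MinorOf (completeBipartiteGraph (Fin s) (Fin t)) G' → specRad G' ≤ specRad G) →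
      K.card = s - 1 → G.IsClique (↑K : Set (Fin n)) →
      (∀ v : Fin n, v ∉ K → ∀ u ∈ K, G.Adj u v) →
      (∃ c : (G.comap (Subtype.val : {v : Fin n // v ∉ K} → Fin n)).ConnectedComponent,
        c.supp.ncard = t + 1) →
      ∀ c : (G.comap (Subtype.val : {v : Fin n // v ∉ K} → Fin n)).ConnectedComponent,
        t ≤ c.supp.ncard ∧ c.supp.ncard ≠ t + 2 := by
  refine ⟨(4 * t ^ 5 + 2 * t) ^ 2 + t ^ 5 + t ^ 2 + 1 + s, ?_⟩
  intro n hn G K hfree hmax hK hc hd ⟨C, hC⟩ c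
  have hcard : Fintype.card {v : Fin n // v ∉ K} = n - (s - 1) := by
    rw [Fintype.card_subtype_compl, Fintype.card_fin, Fintype.card_coe, hK]
  have hge : (4 * t ^ 5 + 2 * t) ^ 2 + t ^ 5 + t ^ 2 < Fintype.card {v : Fin n // v ∉ K} := by
    omega
  have hne : Nonempty {v : Fin n // v ∉ K} := Fintype.card_pos_iff.1 (by omega)
  obtain ⟨ρ, x, hρ, hx, heq, hsum, hm⟩ := spectral_principle s t hs hst G K hmax hK hc hd hne
  have hk : (1 : ℝ) ≤ ((s - 1 : ℕ) : ℝ) := by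
    have : 1 ≤ s - 1 := by omega
    exact_mod_cast this
  have E : ExtG s t (G.comap (Subtype.val : {v : Fin n // v ∉ K} → Fin n)) ρ ((s - 1 : ℕ) : ℝ) x :=
    ⟨free_join G K hK hc hd hfree, hs, ht, hk, hρ, hx, heq, hm⟩
  refine final_abs E ?_ (by omega) C c hC
  -- the spectral radius is large
  have h1 : ∀ v, 1 ≤ ρ * x v := by
    intro v
    rw [heq v]
    have := Finset.sum_nonneg
      (s := NF (G.comap (Subtype.val : {v : Fin n // v ∉ K} → Fin n)) v) (fun u _ => (hx u).le)
    linarith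
  have h2 : (Fintype.card {v : Fin n // v ∉ K} : ℝ) ≤ ρ * ∑ v, x v := by
    rw [Finset.mul_sum]
    have := Finset.card_nsmul_le_sum Finset.univ (fun v => ρ * x v) 1 (fun v _ => h1 v)
    rw [nsmul_eq_mul, mul_one] at this
    exact this
  have h3 : ρ * ∑ v, x v ≤ ρ * ρ := mul_le_mul_of_nonneg_left (by linarith) hρ.le
  have h4 : ((4 * (t : ℝ) ^ 5 + 2 * t) ^ 2) ≤ ρ ^ 2 := by
    have h5 : (((4 * t ^ 5 + 2 * t) ^ 2 : ℕ) : ℝ) ≤ (Fintype.card {v : Fin n // v ∉ K} : ℝ) := by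
      exact_mod_cast (by omega)
    push_cast at h5
    nlinarith
  exact le_of_sq_le_sq h4 hρ.le

end PartMain

/-- Lemma 4.3: if some component of G⋆ − K has t+1 vertices, then no component has
fewer than t vertices or exactly t+2 vertices. -/
theorem components_with_t_plus_one (s t : ℕ) (ht : 4 ≤ t) (hs : 2 ≤ s) (hst : s ≤ t) :
    ∃ n₀ : ℕ, ∀ n : ℕ, n₀ ≤ n →
    ∀ (G : SimpleGraph (Fin n)) (K : Finset (Fin n)),
      ¬ MinorOf (completeBipartiteGraph (Fin s) (Fin t)) G →
      (∀ G' : SimpleGraph (Fin n),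
        ¬ MinorOf (completeBipartiteGraph (Fin s) (Fin t)) G' → specRad G' ≤ specRad G) →
      K.card = s - 1 → G.IsClique (↑K : Set (Fin n)) →
      (∀ v : Fin n, v ∉ K → ∀ u ∈ K, G.Adj u v) →
      (∃ c : (G.comap (Subtype.val : {v : Fin n // v ∉ K} → Fin n)).ConnectedComponent,
        c.supp.ncard = t + 1) →
      ∀ c : (G.comap (Subtype.val : {v : Fin n // v ∉ K} → Fin n)).ConnectedComponent,
        t ≤ c.supp.ncard ∧ c.supp.ncard ≠ t + 2 := by
  exact main_thm s t ht hs hst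
end

section
/- Let t ≥ 3 and n ≥ t+1, and let G* attain the maximum spectral radius ρ among all n-vertex connected K_{1,t}-minor free graphs. Let X be a positive eigenvector of the adjacency matrix of G* for ρ, u* a vertex at which X attains its maximum entry, A = N(u*) the neighborhood of u*, B = V(G*) ∖ (A ∪ {u*}), and A_1 = {v ∈ A : v has at least one non-neighbor in A ∖ {v}}. Then: (i) every vertex of A_1 has at most one neighbor in B; and (ii) every vertex w ∈ B has at most two neighbors in B, and if w is at distance 2 from u* in G*, then w has at most one neighbor in B. -/
open SimpleGraph

theorem minor_of_connected_set {n t : ℕ} (G : SimpleGraph (Fin n)) (S : Set (Fin n))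
    (hS : (G.induce S).Connected) (T : Finset (Fin n)) (hT : t ≤ T.card)
    (h : ∀ y ∈ T, y ∉ S ∧ ∃ x ∈ S, G.Adj x y) :
    MinorOf (completeBipartiteGraph (Fin 1) (Fin t)) G := by
  obtain ⟨T', hT', hc⟩ := Finset.exists_subset_card_eq hT
  let e : Fin t ≃ T' := (T'.equivFinOfCardEq hc).symm
  have he : ∀ i, (e i : Fin n) ∈ T := fun i => hT' (e i).2
  refine ⟨Sum.elim (fun _ => S) (fun i => {(e i : Fin n)}), ?_, ?_, ?_⟩
  · rintro (a | i)
    · exact hS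
    · simp only [Sum.elim_inr]
      rw [induce_singleton_eq_top]
      exact connected_top
  · rintro (a | i) (b | j) hab
    · exact absurd (by rw [Subsingleton.elim a b]) hab
    · simpa using (h _ (he j)).1
    · simpa using (h _ (he i)).1
    · simp only [Sum.elim_inr, Set.disjoint_singleton]
      intro hh
      exact hab (by rw [e.injective (Subtype.ext hh)])
  · rintro (a | i) (b | j) hab
    · simp at hab
    · obtain ⟨x, hx, hxy⟩ := (h _ (he j)).2
      exact ⟨x, hx, _, rfl, hxy⟩
    · obtain ⟨x, hx, hxy⟩ := (h _ (he i)).2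
      exact ⟨_, rfl, x, hx, hxy.symm⟩
    · simp at hab

theorem connected_set_of_minor {n t : ℕ} (G : SimpleGraph (Fin n))
    (h : MinorOf (completeBipartiteGraph (Fin 1) (Fin t)) G) :
    ∃ (S : Set (Fin n)) (T : Finset (Fin n)), (G.induce S).Connected ∧ T.card = t ∧
      ∀ y ∈ T, y ∉ S ∧ ∃ x ∈ S, G.Adj x y := by
  classical
  obtain ⟨φ, h1, h2, h3⟩ := h
  have h4 : ∀ i : Fin t, ∃ y ∈ φ (Sum.inr i), ∃ x ∈ φ (Sum.inl 0), G.Adj x y := by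
    intro i
    obtain ⟨x, hx, y, hy, hxy⟩ := h3 (Sum.inl 0) (Sum.inr i) (by simp)
    exact ⟨y, hy, x, hx, hxy⟩
  choose f hf hf' using h4
  refine ⟨φ (Sum.inl 0), Finset.univ.image f, h1 _, ?_, ?_⟩
  · rw [Finset.card_image_of_injective]
    · simp
    · intro i j hij
      by_contra hne
      have := h2 (show (Sum.inr i : Fin 1 ⊕ Fin t) ≠ Sum.inr j by simpa using hne)
      exact Set.disjoint_left.1 this (hf i) (hij ▸ hf j)
  · intro y hy
    obtain ⟨i, -, rfl⟩ := Finset.mem_image.1 hy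
    refine ⟨fun hh => ?_, hf' i⟩
    exact Set.disjoint_left.1 (h2 (show (Sum.inr i : Fin 1 ⊕ Fin t) ≠ Sum.inl 0 by simp)) (hf i) hh

theorem rayleigh_le_s18 {n : ℕ} (G : SimpleGraph (Fin n)) (x : Fin n → ℝ) :
    x ⬝ᵥ (adjMat G).mulVec x ≤ specRad G * (x ⬝ᵥ x) := by
  have hA := adjMat_herm G
  set A := adjMat G with hAdef
  let b := hA.eigenvectorBasis
  let y : EuclideanSpace ℝ (Fin n) := WithLp.toLp 2 x
  let z : EuclideanSpace ℝ (Fin n) := WithLp.toLp 2 (A.mulVec x)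
  have hdot : ∀ p q : EuclideanSpace ℝ (Fin n), inner ℝ p q = (p : Fin n → ℝ) ⬝ᵥ (q : Fin n → ℝ) := by
    intro p q
    simp [PiLp.inner_apply, dotProduct, mul_comm]
  have e1 : x ⬝ᵥ x = ∑ i, inner ℝ y (b i) * inner ℝ (b i) y := by
    rw [b.sum_inner_mul_inner, hdot]
  have e2 : x ⬝ᵥ A.mulVec x = ∑ i, inner ℝ y (b i) * inner ℝ (b i) z := by
    rw [b.sum_inner_mul_inner, hdot]
  have e3 : ∀ i, inner ℝ (b i) z = hA.eigenvalues i * inner ℝ (b i) y := by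
    intro i
    rw [hdot, hdot]
    change (b i : Fin n → ℝ) ⬝ᵥ A.mulVec x = _ * ((b i : Fin n → ℝ) ⬝ᵥ x)
    have hsymm : A.transpose = A := by
      have := hA.eq
      rwa [Matrix.conjTranspose_eq_transpose_of_trivial] at this
    rw [Matrix.dotProduct_mulVec, ← Matrix.mulVec_transpose, hsymm, hA.mulVec_eigenvectorBasis,
      smul_dotProduct, smul_eq_mul]
  rw [e1, e2, Finset.mul_sum]
  refine Finset.sum_le_sum fun i _ => ?_
  rw [e3, real_inner_comm y (b i)]
  have hle : hA.eigenvalues i ≤ specRad G :=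
    le_ciSup (f := fun i => hA.eigenvalues i) (Set.finite_range _).bddAbove i
  nlinarith [mul_self_nonneg (inner ℝ y (b i)), mul_le_mul_of_nonneg_right hle (mul_self_nonneg (inner ℝ y (b i)))]

theorem adjMat_mulVec_s18 {n : ℕ} (G : SimpleGraph (Fin n)) [DecidableRel G.Adj] (x : Fin n → ℝ)
    (i : Fin n) : (adjMat G).mulVec x i = ∑ j ∈ G.neighborFinset i, x j := by
  unfold adjMat
  rw [← SimpleGraph.adjMatrix_mulVec_apply]
  congr!

/-- clique on `0..k` with a pendant path attached at `k` -/
def kite (n k : ℕ) : SimpleGraph (Fin n) where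
  Adj i j := i ≠ j ∧ ((i.1 ≤ k ∧ j.1 ≤ k) ∨ i.1 + 1 = j.1 ∨ j.1 + 1 = i.1)
  symm := ⟨by rintro i j ⟨h, h'⟩; exact ⟨h.symm, by tauto⟩⟩
  loopless := ⟨fun i h => h.1 rfl⟩

theorem kite_connected {n k : ℕ} (hn : 0 < n) : (kite n k).Connected := by
  obtain ⟨m, rfl⟩ : ∃ m, n = m + 1 := ⟨n - 1, by omega⟩
  refine (pathGraph_connected m).mono ?_
  intro i j hij
  rw [pathGraph_adj] at hij
  exact ⟨by rintro rfl; omega, Or.inr hij⟩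

theorem kite_convex {n k : ℕ} (S : Set (Fin n)) (hS : ((kite n k).induce S).Connected)
    {a b y : Fin n} (ha : a ∈ S) (hb : b ∈ S) (hay : a < y) (hyb : y < b) (hk : k < y.1) :
    y ∈ S := by
  by_contra hy
  obtain ⟨p⟩ := hS.preconnected ⟨a, ha⟩ ⟨b, hb⟩
  have key : ∀ (c d : S), ((kite n k).induce S).Walk c d → c.1 < y → d.1 < y := by
    intro c d p
    induction p with
    | nil => exact id
    | @cons c e d h p ih =>
      intro hc
      apply ih
      have h' : (kite n k).Adj c.1 e.1 := h
      obtain ⟨h1, h2⟩ := h'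
      have : e.1 ≠ y := fun h => hy (h ▸ e.2)
      have : e.1.1 ≠ y.1 := fun h => this (Fin.ext h)
      rw [Fin.lt_def] at hc ⊢
      omega
  exact absurd (key _ _ p hay) (not_lt.2 hyb.le)

theorem kite_free {n k : ℕ} (hk : 1 ≤ k) :
    ¬ MinorOf (completeBipartiteGraph (Fin 1) (Fin (k + 2))) (kite n k) := by
  classical
  intro h
  obtain ⟨S, T, hS, hT, hadj⟩ := connected_set_of_minor _ h
  have hne : S.toFinset.Nonempty := by
    obtain ⟨⟨x, hx⟩⟩ := hS.nonempty
    exact ⟨x, by simpa using hx⟩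
  set m := S.toFinset.min' hne with hm
  set M := S.toFinset.max' hne with hM
  have hmS : m ∈ S := by simpa using S.toFinset.min'_mem hne
  have hMS : M ∈ S := by simpa using S.toFinset.max'_mem hne
  have hmle : ∀ x ∈ S, m.1 ≤ x.1 := fun x hx => S.toFinset.min'_le x (by simpa using hx)
  have hleM : ∀ x ∈ S, x.1 ≤ M.1 := fun x hx => S.toFinset.le_max' x (by simpa using hx)
  have hcard : (T.image Fin.val).card = k + 2 := by
    rw [Finset.card_image_of_injective _ Fin.val_injective, hT]
  have hy : ∀ y ∈ T, y.1 ≠ m.1 ∧ y.1 ≠ M.1 ∧ (k < y.1 → y.1 < m.1 ∨ M.1 < y.1) := by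
    intro y hy
    have hyS := (hadj y hy).1
    have h1 : y.1 ≠ m.1 := fun h => hyS ((Fin.ext h : y = m) ▸ hmS)
    have h2 : y.1 ≠ M.1 := fun h => hyS ((Fin.ext h : y = M) ▸ hMS)
    refine ⟨h1, h2, fun hky => ?_⟩
    by_contra hcon
    exact hyS (kite_convex S hS hmS hMS (Fin.lt_def.2 (by omega)) (Fin.lt_def.2 (by omega)) hky)
  by_cases hmk : m.1 ≤ k
  · have hsub : T.image Fin.val ⊆ insert (M.1 + 1) ((Finset.range (k + 1)).erase m.1) := by
      intro j hj
      obtain ⟨y, hyT, rfl⟩ := Finset.mem_image.1 hj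
      obtain ⟨h1, h2, h3⟩ := hy y hyT
      obtain ⟨x, hx, hxy⟩ := (hadj y hyT).2
      obtain ⟨h4, h5⟩ := hxy
      have := hmle x hx
      have := hleM x hx
      simp only [Finset.mem_insert, Finset.mem_erase, Finset.mem_range]
      omega
    have := Finset.card_le_card hsub
    have h2 := Finset.card_insert_le (M.1 + 1) ((Finset.range (k + 1)).erase m.1)
    rw [Finset.card_erase_of_mem (by simp; omega), Finset.card_range] at h2
    omega
  · have hsub : T.image Fin.val ⊆ {m.1 - 1, M.1 + 1} := by
      intro j hj
      obtain ⟨y, hyT, rfl⟩ := Finset.mem_image.1 hj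
      obtain ⟨h1, h2, h3⟩ := hy y hyT
      obtain ⟨x, hx, hxy⟩ := (hadj y hyT).2
      obtain ⟨h4, h5⟩ := hxy
      have := hmle x hx
      have := hleM x hx
      simp only [Finset.mem_insert, Finset.mem_singleton]
      omega
    have := Finset.card_le_card hsub
    have h2 := Finset.card_le_two (a := m.1 - 1) (b := M.1 + 1)
    omega

theorem kite_specRad {n k : ℕ} (hk : 1 ≤ k) (hn : k + 2 ≤ n) : (k : ℝ) < specRad (kite n k) := by
  classical
  let x : Fin n → ℝ := fun i => if i.1 ≤ k then (k : ℝ) else if i.1 = k + 1 then 1 else 0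
  have hx0 : ∀ i, 0 ≤ x i := by
    intro i
    simp only [x]
    split_ifs <;> positivity
  have hkpos : (0 : ℝ) < k := by exact_mod_cast hk
  let c : Fin n := ⟨k, by omega⟩
  let d : Fin n := ⟨k + 1, by omega⟩
  have hxc : x c = k := by simp [x, c]
  have hxd : x d = 1 := by simp [x, d]
  have hlow : ∀ i (F : Finset (Fin n)), (∀ j ∈ F, (kite n k).Adj i j) →
      ∑ j ∈ F, x j ≤ (adjMat (kite n k)).mulVec x i := by
    intro i F hF
    rw [adjMat_mulVec_s18]
    refine Finset.sum_le_sum_of_subset_of_nonneg ?_ (fun j _ _ => hx0 j)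
    intro j hj
    simpa using hF j hj
  let Q : Finset (Fin n) := Finset.univ.filter fun j => j.1 ≤ k
  have hQ : Q.card = k + 1 := by
    have : Q = Finset.Iic c := by
      ext j; simp [Q, c, Fin.le_def]
    rw [this, Fin.card_Iic]
  have hQsum : ∀ i ∈ Q, ∑ j ∈ Q.erase i, x j = k * k := by
    intro i hi
    rw [Finset.sum_congr rfl (g := fun _ => (k : ℝ))]
    · rw [Finset.sum_const, Finset.card_erase_of_mem hi, hQ]
      simp
    · intro j hj
      have := (Finset.mem_filter.1 (Finset.mem_of_mem_erase hj)).2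
      simp [x, this]
  have hpt : ∀ i, k * x i ≤ (adjMat (kite n k)).mulVec x i := by
    intro i
    by_cases hi : i.1 ≤ k
    · have hiQ : i ∈ Q := by simp [Q, hi]
      have : x i = k := by simp [x, hi]
      rw [this, ← hQsum i hiQ]
      apply hlow
      intro j hj
      have h1 := Finset.ne_of_mem_erase hj
      have h2 := (Finset.mem_filter.1 (Finset.mem_of_mem_erase hj)).2
      exact ⟨h1.symm, Or.inl ⟨hi, h2⟩⟩
    · by_cases hi2 : i.1 = k + 1
      · have : x i = 1 := by simp [x, hi2]
        have h := hlow i {c} (by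
          intro j hj
          rw [Finset.mem_singleton] at hj
          subst hj
          refine ⟨?_, Or.inr (Or.inr ?_)⟩
          · rintro rfl; simp [c] at hi
          · simp [c, hi2])
        rw [Finset.sum_singleton, hxc] at h
        rw [this]; linarith
      · have : x i = 0 := by simp [x, hi, hi2]
        rw [this]
        simpa using hlow i ∅ (by simp)
  have hstrict : k * x c + 1 ≤ (adjMat (kite n k)).mulVec x c := by
    have hcQ : c ∈ Q := by simp [Q, c]
    have hdQ : d ∉ Q.erase c := by simp [Q, d]
    have h := hlow c (insert d (Q.erase c)) (by
      intro j hj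
      rcases Finset.mem_insert.1 hj with rfl | hj
      · refine ⟨?_, Or.inr (Or.inl rfl)⟩
        intro h; simp [c, d] at h
      · have h1 := Finset.ne_of_mem_erase hj
        have h2 := (Finset.mem_filter.1 (Finset.mem_of_mem_erase hj)).2
        exact ⟨h1.symm, Or.inl ⟨le_refl k, h2⟩⟩)
    rw [Finset.sum_insert hdQ, hQsum c hcQ, hxd] at h
    rw [hxc]; linarith
  have hlt : k * (x ⬝ᵥ x) < x ⬝ᵥ (adjMat (kite n k)).mulVec x := by
    simp only [dotProduct, Finset.mul_sum]
    refine Finset.sum_lt_sum (fun i _ => ?_) ⟨c, Finset.mem_univ _, ?_⟩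
    · nlinarith [hpt i, hx0 i, mul_le_mul_of_nonneg_left (hpt i) (hx0 i)]
    · rw [hxc] at *
      nlinarith
  have hpos : 0 < x ⬝ᵥ x := by
    refine Finset.sum_pos' (fun i _ => mul_self_nonneg _) ⟨c, Finset.mem_univ _, ?_⟩
    rw [hxc]; positivity
  have := rayleigh_le_s18 (kite n k) x
  exact lt_of_mul_lt_mul_right (hlt.trans_le this) hpos.le

theorem exists_geodesic_set {n : ℕ} (G : SimpleGraph (Fin n)) (hconn : G.Connected) (u : Fin n) :
    ∀ (k : ℕ) (w : Fin n), G.dist u w = k → ∃ S : Set (Fin n), (G.induce S).Connected ∧ u ∈ S ∧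
      w ∈ S ∧ (∀ x ∈ S, G.dist u x ≤ k) ∧
      ∀ x ∈ S, ∀ y ∈ S, G.dist u x = G.dist u y → x = y := by
  intro k
  induction k with
  | zero =>
    intro w hw
    have : u = w := hconn.dist_eq_zero_iff.1 hw
    subst this
    refine ⟨{u}, ?_, rfl, rfl, ?_, ?_⟩
    · rw [induce_singleton_eq_top]
      exact connected_top
    · rintro x rfl; simp
    · rintro x rfl y rfl _; rfl
  | succ k ih =>
    intro w hw
    obtain ⟨p, hp⟩ := hconn.exists_walk_length_eq_dist w u
    rw [dist_comm, hw] at hp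
    cases p with
    | nil => simp at hp
    | @cons _ v _ h p =>
      rw [Walk.length_cons] at hp
      have h1 : G.dist u v ≤ k := by
        rw [dist_comm]; exact (dist_le p).trans (by omega)
      have h2 := hconn.dist_triangle (u := u) (v := v) (w := w)
      have h3 : G.dist v w = 1 := dist_eq_one_iff_adj.2 h.symm
      obtain ⟨S, hS, huS, hvS, hle, hinj⟩ := ih v (by omega)
      refine ⟨S ∪ {v, w}, ?_, Or.inl huS, Or.inr (by simp), ?_, ?_⟩
      · exact induce_union_connected hS.preconnected
          (induce_pair_connected_of_adj h.symm).preconnected ⟨v, hvS, by simp⟩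
      · rintro x (hx | rfl | rfl)
        · exact (hle x hx).trans (by omega)
        · omega
        · omega
      · have hcase : ∀ x ∈ S ∪ {v, w}, x ∈ S ∨ x = w := by
          rintro x (hx | rfl | rfl)
          · exact Or.inl hx
          · exact Or.inl hvS
          · exact Or.inr rfl
        intro x hx y hy hxy
        rcases hcase x hx with hx1 | hx1 <;> rcases hcase y hy with hy1 | hy1
        · exact hinj x hx1 y hy1 hxy
        · have := hle x hx1; rw [hy1] at hxy; omega
        · have := hle y hy1; rw [hx1] at hxy; omega
        · rw [hx1, hy1]

theorem geodesic_bound {n t : ℕ} (ht : 3 ≤ t) (G : SimpleGraph (Fin n)) (hconn : G.Connected)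
    (hfree : ¬ MinorOf (completeBipartiteGraph (Fin 1) (Fin t)) G) (u : Fin n)
    (hdeg : t - 1 ≤ (G.neighborSet u).ncard) (w : Fin n) (hw : w ≠ u) :
    (G.neighborSet w ∩ {x : Fin n | x ≠ u ∧ ¬ G.Adj u x}).ncard ≤ 2 ∧
    (G.dist u w ≤ 2 →
      (G.neighborSet w ∩ {x : Fin n | x ≠ u ∧ ¬ G.Adj u x}).ncard ≤ 1) := by
  classical
  obtain ⟨S, hS, huS, hwS, hle, hinj⟩ := exists_geodesic_set G hconn u _ w rfl
  set NB := G.neighborSet w ∩ {x : Fin n | x ≠ u ∧ ¬ G.Adj u x} with hNB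
  have hA : t - 2 ≤ (G.neighborSet u \ S).ncard := by
    have h1 : (G.neighborSet u ∩ S).ncard ≤ 1 := by
      rw [Set.ncard_le_one]
      rintro a ⟨ha, haS⟩ b ⟨hb, hbS⟩
      refine hinj a haS b hbS ?_
      rw [dist_eq_one_iff_adj.2 ha, dist_eq_one_iff_adj.2 hb]
    have h2 := Set.ncard_inter_add_ncard_sdiff_eq_ncard (G.neighborSet u) S
    omega
  have hBS : (NB \ S).ncard ≤ 1 := by
    by_contra hcon
    apply hfree
    refine minor_of_connected_set G S hS ((G.neighborSet u \ S) ∪ (NB \ S)).toFinset ?_ ?_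
    · rw [← Set.ncard_eq_toFinset_card', Set.ncard_union_eq]
      · omega
      · rw [Set.disjoint_left]
        rintro a ⟨ha, -⟩ ⟨⟨-, -, hb⟩, -⟩
        exact hb ha
    · intro y hy
      rw [Set.mem_toFinset] at hy
      rcases hy with ⟨hy, hyS⟩ | ⟨⟨hy, -⟩, hyS⟩
      · exact ⟨hyS, u, huS, hy⟩
      · exact ⟨hyS, w, hwS, hy⟩
  have hsplit := Set.ncard_inter_add_ncard_sdiff_eq_ncard NB S
  have hd : ∀ x ∈ NB ∩ S, G.dist u x + 1 = G.dist u w ∧ 2 ≤ G.dist u x := by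
    rintro x ⟨⟨hx, hxu, hxa⟩, hxS⟩
    have h1 := hle x hxS
    have h2 := hconn.dist_triangle (u := u) (v := x) (w := w)
    have h3 : G.dist x w = 1 := dist_eq_one_iff_adj.2 (SimpleGraph.Adj.symm hx)
    have h4 : G.dist u x ≠ G.dist u w := fun h => by
      have := hinj x hxS w hwS h
      subst this
      exact G.loopless.irrefl _ hx
    have h5 : G.dist u x ≠ 0 := fun h => hxu (hconn.dist_eq_zero_iff.1 h).symm
    have h6 : G.dist u x ≠ 1 := fun h => hxa (dist_eq_one_iff_adj.1 h)
    omega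
  constructor
  · have : (NB ∩ S).ncard ≤ 1 := by
      rw [Set.ncard_le_one]
      intro a ha b hb
      have := hd a ha
      have := hd b hb
      exact hinj a ha.2 b hb.2 (by omega)
    omega
  · intro h
    have : NB ∩ S = ∅ := by
      ext x
      simp only [Set.mem_empty_iff_false, iff_false]
      intro hx
      have := hd x hx
      omega
    rw [this, Set.ncard_empty] at hsplit
    omega

/-- Lemma 5.3: neighbor bounds in B. -/
theorem neighbors_in_B (t n : ℕ) (ht : 3 ≤ t) (hn : t + 1 ≤ n)
    (G : SimpleGraph (Fin n)) (hconn : G.Connected)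
    (hfree : ¬ MinorOf (completeBipartiteGraph (Fin 1) (Fin t)) G)
    (hmax : ∀ G' : SimpleGraph (Fin n), G'.Connected →
      ¬ MinorOf (completeBipartiteGraph (Fin 1) (Fin t)) G' → specRad G' ≤ specRad G)
    (X : Fin n → ℝ) (hX : ∀ v, 0 < X v)
    (heig : (adjMat G).mulVec X = specRad G • X)
    (u : Fin n) (hu : ∀ v, X v ≤ X u) :
    (∀ v : Fin n, G.Adj u v → (∃ w : Fin n, G.Adj u w ∧ w ≠ v ∧ ¬ G.Adj v w) →
      (G.neighborSet v ∩ {w : Fin n | w ≠ u ∧ ¬ G.Adj u w}).ncard ≤ 1) ∧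
    (∀ w : Fin n, w ≠ u → ¬ G.Adj u w →
      (G.neighborSet w ∩ {x : Fin n | x ≠ u ∧ ¬ G.Adj u x}).ncard ≤ 2 ∧
      (G.dist u w = 2 →
        (G.neighborSet w ∩ {x : Fin n | x ≠ u ∧ ¬ G.Adj u x}).ncard ≤ 1)) := by
  classical
  have hk : (((t - 2 : ℕ) : ℕ) : ℝ) < specRad G := by
    have h1 := kite_specRad (n := n) (k := t - 2) (by omega) (by omega)
    have h2 := kite_free (n := n) (k := t - 2) (by omega)
    rw [show t - 2 + 2 = t by omega] at h2
    exact h1.trans_le (hmax _ (kite_connected (by omega)) h2)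
  have hdeg : t - 1 ≤ (G.neighborSet u).ncard := by
    have h := congrFun heig u
    rw [adjMat_mulVec_s18, Pi.smul_apply, smul_eq_mul] at h
    have h2 : ∑ j ∈ G.neighborFinset u, X j ≤ (G.neighborFinset u).card * X u := by
      rw [← nsmul_eq_mul]
      exact Finset.sum_le_card_nsmul _ _ _ (fun j _ => hu j)
    rw [h] at h2
    have h3 := le_of_mul_le_mul_right h2 (hX u)
    have h4 := hk.trans_le h3
    have h5 : t - 2 < (G.neighborFinset u).card := by exact_mod_cast h4
    rw [Set.ncard_eq_toFinset_card']
    have h6 : (G.neighborSet u).toFinset = G.neighborFinset u := rfl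
    rw [h6]
    omega
  refine ⟨fun v hv _ => ?_, fun w hw _ => ?_⟩
  · refine (geodesic_bound ht G hconn hfree u hdeg v hv.ne').2 ?_
    rw [dist_eq_one_iff_adj.2 hv]
    omega
  · have h := geodesic_bound ht G hconn hfree u hdeg w hw
    exact ⟨h.1, fun h' => h.2 h'.le⟩
end

section
/- Let t ≥ 3 and n ≥ t+1, and let G* attain the maximum spectral radius ρ among all n-vertex connected K_{1,t}-minor free graphs. Let X = (x_v) be a positive eigenvector of the adjacency matrix of G* for ρ, u* a vertex at which X attains its maximum entry, A = N(u*), B = V(G*) ∖ (A ∪ {u*}), and A_1 = {v ∈ A : v has at least one non-neighbor in A ∖ {v}}. If v_1 ∈ A_1 and w ∈ B are adjacent in G*, then x_w ≤ Σ_{v} x_v, where the sum runs over all v ∈ A ∖ {v_1} that are not adjacent to v_1. -/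
open SimpleGraph

/-- Lemma 5.4: eigenvector entry bound for neighbors of A₁ in B. -/
theorem eigenvector_entry_bound (t n : ℕ) (ht : 3 ≤ t) (hn : t + 1 ≤ n)
    (G : SimpleGraph (Fin n)) (hconn : G.Connected)
    (hfree : ¬ MinorOf (completeBipartiteGraph (Fin 1) (Fin t)) G)
    (hmax : ∀ G' : SimpleGraph (Fin n), G'.Connected →
      ¬ MinorOf (completeBipartiteGraph (Fin 1) (Fin t)) G' → specRad G' ≤ specRad G)
    (X : Fin n → ℝ) (hX : ∀ v, 0 < X v)
    (heig : (adjMat G).mulVec X = specRad G • X)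
    (u : Fin n) (hu : ∀ v, X v ≤ X u)
    (v₁ w : Fin n)
    (hv₁A : G.Adj u v₁)
    (hv₁A1 : ∃ x : Fin n, G.Adj u x ∧ x ≠ v₁ ∧ ¬ G.Adj v₁ x)
    (hwB : w ≠ u ∧ ¬ G.Adj u w)
    (hadj : G.Adj v₁ w) :
    X w ≤ ∑ᶠ v ∈ {v : Fin n | G.Adj u v ∧ v ≠ v₁ ∧ ¬ G.Adj v₁ v}, X v := by
  classical
  have key : ∀ v, ∑ y, (if G.Adj v y then X y else 0) = specRad G * X v := by
    intro v
    have h := congrFun heig v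
    simp only [Pi.smul_apply, smul_eq_mul] at h
    rw [← h]
    simp [adjMat, Matrix.mulVec, dotProduct, SimpleGraph.adjMatrix_apply]
  have hρ : 0 ≤ specRad G := by
    have h : 0 ≤ specRad G * X u := by
      rw [← key u]
      apply Finset.sum_nonneg
      intro y _
      split_ifs
      · exact (hX y).le
      · exact le_rfl
    exact nonneg_of_mul_nonneg_left h (hX u)
  have h1 : specRad G * X v₁ ≤ specRad G * X u := mul_le_mul_of_nonneg_left (hu v₁) hρ
  rw [← key, ← key] at h1
  have h2 : ∑ y, ((if G.Adj u y then X y else 0) + (if y = u then X y else 0)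
        + (if y = w then X y else 0)) ≤
      ∑ y, ((if G.Adj v₁ y then X y else 0) + (if y = v₁ then X y else 0)
        + (if G.Adj u y ∧ y ≠ v₁ ∧ ¬ G.Adj v₁ y then X y else 0)) := by
    apply Finset.sum_le_sum
    intro y _
    have hy := hX y
    by_cases hyu : y = u
    · subst hyu
      simp [hv₁A.symm, hwB.1.symm, hv₁A.ne]
    · by_cases hyw : y = w
      · subst hyw
        simp [hwB.1, hwB.2, hadj, hadj.ne.symm]
      · by_cases hc : y = v₁
        · subst hc
          simp [hyu, hyw, hv₁A]
        · by_cases ha : G.Adj u y <;> by_cases hb : G.Adj v₁ y <;>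
            simp [hyu, hyw, ha, hb, hc, hy.le]
  simp only [Finset.sum_add_distrib, Finset.sum_ite_eq', Finset.mem_univ, if_true] at h2
  have h3 : ∑ᶠ v ∈ {v : Fin n | G.Adj u v ∧ v ≠ v₁ ∧ ¬ G.Adj v₁ v}, X v
      = ∑ y, (if G.Adj u y ∧ y ≠ v₁ ∧ ¬ G.Adj v₁ y then X y else 0) := by
    rw [finsum_eq_sum_of_fintype]
    apply Finset.sum_congr rfl
    intro y _
    rw [finsum_eq_if]
    rfl
  rw [h3]
  linarith [hu v₁]
end
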